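/- arXiv:1301.0663 — 5 statements merged into one kernel-verified Lean document; each statement's English description precedes it below -/
import Mathlib

section
/- Let r₁,…,r_s ∈ ℂ and let e₀,e₁,…,e_s be positive integers. Put R = max{1,|r₁|,…,|r_s|} and E = e₀+e₁+⋯+e_s. Then there is a unique polynomial a(X) ∈ ℂ[X] of degree < e₀ such that a(X)·∏_{i=1}^s (1−r_iX)^{e_i} ≡ 1 (mod X^{e₀}), and its length satisfies 𝓛(a) ≤ C(E−1, e₀−1)·R^{e₀−1}, where C(n,k) denotes the binomial coefficient. -/
open Polynomial

/-- `∑ n, a n Xⁿ` is majorized by `(1 - R X)⁻ᴺ` up to order `M`. -/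
def CoeffMajorized (M : ℕ) (R : ℝ) (N : ℕ) (a : ℂ[X]) : Prop :=
  ∀ n < M, ‖a.coeff n‖ ≤ (Nat.multichoose N n : ℝ) * R ^ n

namespace CoeffMajorized

variable {M N : ℕ} {R : ℝ} {a : ℂ[X]} {r : ℂ}

theorem of_mul_linear (hr : ‖r‖ ≤ R) (h : CoeffMajorized M R N (a * (1 - C r * X))) :
    CoeffMajorized M R (N + 1) a := by
  intro n
  induction n with
  | zero =>
    intro hn
    simpa [mul_coeff_zero] using h 0 hn
  | succ n ih =>
    intro hn
    have hcoeff : a.coeff (n + 1) = (a * (1 - C r * X)).coeff (n + 1) + r * a.coeff n := by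
      rw [show a * (1 - C r * X) = a - C r * (a * X) by ring]
      simp
    have hprev := ih (by omega)
    rw [Nat.multichoose_succ_succ, hcoeff]
    calc _ ≤ ‖(a * (1 - C r * X)).coeff (n + 1)‖ + ‖r‖ * ‖a.coeff n‖ := by
          simpa using norm_add_le ((a * (1 - C r * X)).coeff (n + 1)) (r * a.coeff n)
      _ ≤ (Nat.multichoose N (n + 1) : ℝ) * R ^ (n + 1)
            + R * ((Nat.multichoose (N + 1) n : ℝ) * R ^ n) := by
          have := (norm_nonneg r).trans hr
          gcongr
          exact h _ hn
      _ = _ := by push_cast; ring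

theorem of_mul_linear_pow (hr : ‖r‖ ≤ R) (k : ℕ)
    (h : CoeffMajorized M R N (a * (1 - C r * X) ^ k)) : CoeffMajorized M R (N + k) a := by
  induction k generalizing a with
  | zero => simpa using h
  | succ k ih =>
    rw [pow_succ', ← mul_assoc] at h
    exact (ih h).of_mul_linear hr

theorem of_mul_prod {ι : Type*} (t : Finset ι) {r : ι → ℂ} (e : ι → ℕ)
    (hr : ∀ i ∈ t, ‖r i‖ ≤ R)
    (h : CoeffMajorized M R N (a * ∏ i ∈ t, (1 - C (r i) * X) ^ e i)) :
    CoeffMajorized M R (N + ∑ i ∈ t, e i) a := by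
  classical
  induction t using Finset.induction_on generalizing a with
  | empty => simpa using h
  | insert j t hj ih =>
    rw [Finset.prod_insert hj, ← mul_assoc] at h
    have := (ih (fun i hi => hr i (Finset.mem_insert_of_mem hi)) h).of_mul_linear_pow
      (hr j (Finset.mem_insert_self j t))
    rwa [Finset.sum_insert hj, add_comm (e j), ← add_assoc]

theorem of_X_pow_dvd_sub_one (h : (X : ℂ[X]) ^ M ∣ a - 1) : CoeffMajorized M R 0 a := by
  intro n hn
  have h0 := X_pow_dvd_iff.1 h n hn
  rw [coeff_sub, sub_eq_zero] at h0
  rw [h0, coeff_one]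
  cases n <;> simp

end CoeffMajorized

/-- The length of a polynomial of degree at most `m` majorized by `(1 - R X)⁻ᴺ`. -/
theorem CoeffMajorized.sum_norm_coeff_le {m N : ℕ} {R : ℝ} {a : ℂ[X]} (hR : 1 ≤ R)
    (h : CoeffMajorized (m + 1) R N a) (hdeg : a.degree < (m + 1 : ℕ)) :
    ∑ k ∈ a.support, ‖a.coeff k‖ ≤ (Nat.choose (m + N) m : ℝ) * R ^ m := by
  have hsub : a.support ⊆ Finset.range (m + 1) := fun k hk => by
    have := (le_degree_of_mem_supp k hk).trans_lt hdeg
    exact Finset.mem_range.2 (by exact_mod_cast this)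
  calc ∑ k ∈ a.support, ‖a.coeff k‖ ≤ ∑ k ∈ Finset.range (m + 1), ‖a.coeff k‖ :=
        Finset.sum_le_sum_of_subset_of_nonneg hsub fun _ _ _ => norm_nonneg _
    _ ≤ ∑ k ∈ Finset.range (m + 1), (Nat.multichoose N k : ℝ) * R ^ m := by
        refine Finset.sum_le_sum fun k hk => ?_
        have hk := Finset.mem_range.1 hk
        refine (h k hk).trans ?_
        gcongr
        omega
    _ = (Nat.choose (m + N) m : ℝ) * R ^ m := by
        rw [← Finset.sum_mul, ← Nat.cast_sum, Nat.sum_range_multichoose, Nat.choose_symm_add]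

/-- A polynomial coprime to a monic `q` has a unique reduced inverse modulo `q`. -/
theorem Polynomial.existsUnique_inverse_mod_monic {K : Type*} [Field K] {p q : K[X]}
    (hq : q.Monic) (h : IsCoprime q p) : ∃! a : K[X], a.degree < q.degree ∧ q ∣ a * p - 1 := by
  obtain ⟨u, v, huv⟩ := h
  refine ⟨v %ₘ q, ⟨degree_modByMonic_lt v hq, -u - (v /ₘ q) * p, ?_⟩, ?_⟩
  · linear_combination p * modByMonic_add_div v q + huv
  · rintro b ⟨hb, c, hc⟩
    have hbv : b - v = q * (c * v + b * u) := by
      linear_combination v * hc - b * huv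
    rw [← (modByMonic_eq_self_iff hq).2 hb]
    exact modByMonic_eq_of_dvd_sub hq ⟨_, hbv⟩

theorem stmt2 (s : ℕ) (r : Fin s → ℂ) (e₀ : ℕ) (e : Fin s → ℕ)
    (he₀ : 0 < e₀) (he : ∀ i, 0 < e i) :
    (∃! a : ℂ[X], a.degree < (e₀ : ℕ) ∧
      (X : ℂ[X]) ^ e₀ ∣ (a * ∏ i, (1 - C (r i) * X) ^ e i - 1)) ∧
    ∀ a : ℂ[X], a.degree < (e₀ : ℕ) →
      (X : ℂ[X]) ^ e₀ ∣ (a * ∏ i, (1 - C (r i) * X) ^ e i - 1) →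
      (∑ k ∈ a.support, ‖a.coeff k‖) ≤
        (Nat.choose (e₀ + (∑ i, e i) - 1) (e₀ - 1) : ℝ) *
          (max 1 ((Finset.univ.sup fun i => ‖r i‖₊ : NNReal) : ℝ)) ^ (e₀ - 1) := by
  constructor
  · have hcop : IsCoprime ((X : ℂ[X]) ^ e₀) (∏ i, (1 - C (r i) * X) ^ e i) :=
      IsCoprime.pow_left <| IsCoprime.prod_right fun i _ => IsCoprime.pow_right
        ⟨C (r i), 1, by ring⟩
    simpa using existsUnique_inverse_mod_monic (monic_X_pow e₀) hcop
  · intro a hdeg hdvd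
    obtain ⟨m, rfl⟩ := Nat.exists_eq_add_of_le' he₀
    have hr : ∀ i ∈ Finset.univ,
        ‖r i‖ ≤ max 1 ((Finset.univ.sup fun i => ‖r i‖₊ : NNReal) : ℝ) := fun i hi =>
      le_max_of_le_right (by exact_mod_cast Finset.le_sup (f := fun i => ‖r i‖₊) hi)
    have hmaj := CoeffMajorized.of_mul_prod Finset.univ e hr (.of_X_pow_dvd_sub_one hdvd)
    rw [zero_add] at hmaj
    convert hmaj.sum_norm_coeff_le (le_max_left _ _) hdeg using 4 <;> omega
end

section
/- Let γ = (ξ,η) ∈ 𝒢, let L ∈ ℕ and put M = C(L+2, 2) (a binomial coefficient). Then the ℂ-linear map from ℂ[X]_L to ℂ^M sending Q to the tuple (𝒟^i Q(1,γ))_{0 ≤ i < M} is an isomorphism of ℂ-vector spaces. Moreover, for each Q ∈ ℂ[X]_L one has 𝓛(Q) ≤ c₁(−γ)^L · 8^M · max_{0 ≤ i < M} |𝒟^i Q(1,γ)|. -/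
open MvPolynomial

/-- The derivation `𝒟 = X₀·∂/∂X₁ + X₂·∂/∂X₂` of `ℂ[X₀,X₁,X₂]`. -/
noncomputable def DD : MvPolynomial (Fin 3) ℂ → MvPolynomial (Fin 3) ℂ :=
  fun P => X 0 * pderiv 1 P + X 2 * pderiv 2 P

/-- The norm of a polynomial: the max of the absolute values of its coefficients. -/
noncomputable def pnorm (P : MvPolynomial (Fin 3) ℂ) : ℝ :=
  ((P.support.sup fun v => ‖P.coeff v‖₊ : NNReal) : ℝ)

/-- The length of a polynomial: the sum of the absolute values of its coefficients. -/
noncomputable def plen (P : MvPolynomial (Fin 3) ℂ) : ℝ :=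
  ∑ v ∈ P.support, ‖P.coeff v‖

/-- The automorphism `τ_γ` of `ℂ[X₀,X₁,X₂]`, `τ_γ(P)(X₀,X₁,X₂) = P(X₀, ξX₀+X₁, ηX₂)`. -/
noncomputable def tauG (ξ η : ℂ) : MvPolynomial (Fin 3) ℂ →ₐ[ℂ] MvPolynomial (Fin 3) ℂ :=
  aeval ![X 0, C ξ * X 0 + X 1, C η * X 2]

/-- The ideal `I^{(γ,T)}` generated by the homogeneous polynomials all of whose
derivatives `𝒟^i P`, `0 ≤ i < T`, vanish at `(1,ξ,η)`. -/
noncomputable def Igam (ξ η : ℂ) (T : ℕ) : Ideal (MvPolynomial (Fin 3) ℂ) :=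
  Ideal.span {P | (∃ d, P.IsHomogeneous d) ∧ ∀ i < T, eval ![1, ξ, η] (DD^[i] P) = 0}

/-- Multiplying by a linear factor `X - a` costs a factor `1 + ‖a‖` for a functional that is
bounded on monomials. -/
theorem norm_apply_X_pow_mul_X_sub_C_mul_le (Λ : Polynomial ℂ →ₗ[ℂ] ℂ) {B : ℝ} {d M : ℕ}
    {p : Polynomial ℂ} (a : ℂ)
    (h : ∀ i, i + d < M → ‖Λ (Polynomial.X ^ i * p)‖ ≤ B) (i : ℕ) (hi : i + (d + 1) < M) :
    ‖Λ (Polynomial.X ^ i * ((Polynomial.X - Polynomial.C a) * p))‖ ≤ (1 + ‖a‖) * B := by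
  have e : Polynomial.X ^ i * ((Polynomial.X - Polynomial.C a) * p)
      = Polynomial.X ^ (i + 1) * p - a • (Polynomial.X ^ i * p) := by
    rw [Polynomial.smul_eq_C_mul]; ring
  rw [e, map_sub, map_smul]
  have h1 := h (i + 1) (by omega)
  have h2 := h i (by omega)
  refine (norm_sub_le _ _).trans ?_
  rw [norm_smul]
  have := mul_le_mul_of_nonneg_left h2 (norm_nonneg a)
  linarith

theorem norm_apply_multiset_prod_le (Λ : Polynomial ℂ →ₗ[ℂ] ℂ) {A : ℝ} {M : ℕ}
    (h : ∀ i < M, ‖Λ (Polynomial.X ^ i)‖ ≤ A) (s : Multiset ℕ) (hs : s.card < M) :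
    ‖Λ ((s.map fun l : ℕ => Polynomial.X - Polynomial.C (l : ℂ)).prod)‖
      ≤ (s.map fun l : ℕ => (1 + l : ℝ)).prod * A := by
  have key : ∀ i, i + s.card < M →
      ‖Λ (Polynomial.X ^ i * (s.map fun l : ℕ => Polynomial.X - Polynomial.C (l : ℂ)).prod)‖
        ≤ (s.map fun l : ℕ => (1 + l : ℝ)).prod * A := by
    clear hs
    induction s using Multiset.induction_on with
    | empty => intro i hi; simpa using h i (by simpa using hi)
    | cons a s ih =>
      intro i hi
      rw [Multiset.card_cons] at hi
      have := norm_apply_X_pow_mul_X_sub_C_mul_le Λ (a : ℂ) ih i hi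
      simpa [mul_assoc] using this
  simpa using key 0 (by simpa using hs)

/-- Removing a linear factor `X - a` from the values of a functional supported at the point `k`. -/
theorem norm_apply_X_sub_C_pow_mul_le (μ : Polynomial ℂ →ₗ[ℂ] ℂ) {B : ℝ} {m : ℕ} {k a : ℂ}
    (p : Polynomial ℂ) (hB : 0 ≤ B) (hka : 1 ≤ ‖k - a‖)
    (hμ : ∀ q, μ ((Polynomial.X - Polynomial.C k) ^ m * q) = 0)
    (h : ∀ j < m, ‖μ ((Polynomial.X - Polynomial.C k) ^ j *
      ((Polynomial.X - Polynomial.C a) * p))‖ ≤ B * 2 ^ (m - j)) (j : ℕ) (hj : j ≤ m) :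
    ‖k - a‖ * ‖μ ((Polynomial.X - Polynomial.C k) ^ j * p)‖ ≤ 2 * B * 2 ^ (m - j) := by
  induction hj using Nat.decreasingInduction with
  | self => rw [hμ]; simp; positivity
  | of_succ j hj ih =>
    have e : (k - a) • ((Polynomial.X - Polynomial.C k) ^ j * p)
        = (Polynomial.X - Polynomial.C k) ^ j * ((Polynomial.X - Polynomial.C a) * p)
          - (Polynomial.X - Polynomial.C k) ^ (j + 1) * p := by
      rw [Polynomial.smul_eq_C_mul, Polynomial.C_sub]; ring
    rw [← norm_smul, ← map_smul, e, map_sub]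
    refine (norm_sub_le _ _).trans ?_
    have h1 := h j hj
    have h2 := (le_mul_of_one_le_left (norm_nonneg _) hka).trans ih
    obtain ⟨r, rfl⟩ : ∃ r, m = j + 1 + r := ⟨m - (j + 1), by omega⟩
    rw [show j + 1 + r - j = r + 1 by omega] at h1 ⊢
    rw [show j + 1 + r - (j + 1) = r by omega] at h2
    rw [pow_succ (2 : ℝ)] at h1 ⊢
    linarith

theorem norm_apply_X_sub_C_pow_le (μ : Polynomial ℂ →ₗ[ℂ] ℂ) {m : ℕ} {k : ℂ}
    (hμ : ∀ q, μ ((Polynomial.X - Polynomial.C k) ^ m * q) = 0)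
    (s : Multiset ℕ) (hs : ∀ l ∈ s, 1 ≤ ‖k - (l : ℂ)‖) {B : ℝ} (hB : 0 ≤ B)
    (h : ∀ j < m, ‖μ ((Polynomial.X - Polynomial.C k) ^ j *
      (s.map fun l : ℕ => Polynomial.X - Polynomial.C (l : ℂ)).prod)‖ ≤ B * 2 ^ (m - j))
    (j : ℕ) (hj : j < m) :
    (s.map fun l : ℕ => ‖k - (l : ℂ)‖).prod * ‖μ ((Polynomial.X - Polynomial.C k) ^ j)‖
      ≤ 2 ^ s.card * B * 2 ^ (m - j) := by
  induction s using Multiset.induction_on generalizing B with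
  | empty => simpa using h j hj
  | cons a s ih =>
    have ha := hs a (Multiset.mem_cons_self a s)
    have hpos : 0 < ‖k - (a : ℂ)‖ := by linarith
    have step := norm_apply_X_sub_C_pow_mul_le μ
      (s.map fun l : ℕ => Polynomial.X - Polynomial.C (l : ℂ)).prod hB ha hμ
      (fun j hj => by simpa using h j hj)
    have := ih (fun l hl => hs l (Multiset.mem_cons_of_mem hl))
      (B := 2 * B / ‖k - (a : ℂ)‖) (by positivity) (fun i hi => by
        rw [div_mul_eq_mul_div, le_div_iff₀ hpos, mul_comm]
        exact step i hi.le)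
    rw [mul_div_assoc', div_mul_eq_mul_div, le_div_iff₀ hpos] at this
    simp only [Multiset.map_cons, Multiset.prod_cons, Multiset.card_cons, pow_succ]
    linarith

/-- The nodes different from `k`: every `l ≤ L`, `l ≠ k`, with multiplicity `L + 1 - l`. -/
def otherNodes (L k : ℕ) : Multiset ℕ :=
  ∑ r ∈ Finset.range (L + 1), ((Finset.range (r + 1)).erase k).val

theorem otherNodes_succ (L k : ℕ) :
    otherNodes (L + 1) k = otherNodes L k + ((Finset.range (L + 2)).erase k).val := by
  rw [otherNodes, Finset.sum_range_succ, otherNodes]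

theorem ne_of_mem_otherNodes {L k l : ℕ} (h : l ∈ otherNodes L k) : l ≠ k := by
  rw [otherNodes, Multiset.mem_sum] at h
  obtain ⟨r, -, hr⟩ := h
  exact Finset.ne_of_mem_erase (Finset.mem_val ▸ hr)

theorem card_otherNodes (L k : ℕ) :
    (otherNodes L k).card + (L + 1 - k) = (L + 2).choose 2 := by
  have hc (L : ℕ) : ((Finset.range (L + 1)).erase k).card = if k ≤ L then L else L + 1 := by
    split_ifs with h
    · rw [Finset.card_erase_of_mem (by simp; omega)]; simp
    · rw [Finset.erase_eq_of_notMem (by simp; omega)]; simp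
  induction L with
  | zero =>
    have := hc 0
    simp only [otherNodes, Finset.sum_range_one, Finset.card_val, zero_add] at this ⊢
    rw [this]; simp; split_ifs <;> omega
  | succ L ih =>
    have h2 : (L + 1 + 2).choose 2 = (L + 2) + (L + 2).choose 2 := by
      rw [Nat.choose_succ_succ' (L + 2) 1, Nat.choose_one_right]
    rw [otherNodes_succ, Multiset.card_add, Finset.card_val, hc (L + 1), h2]
    split_ifs <;> omega

theorem X_sub_C_pow_dvd_otherNodes_prod (L k l : ℕ) (hl : l ≠ k) :
    (Polynomial.X - Polynomial.C (l : ℂ)) ^ (L + 1 - l) ∣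
      ((otherNodes L k).map fun l : ℕ => Polynomial.X - Polynomial.C (l : ℂ)).prod := by
  induction L with
  | zero =>
    rcases Nat.eq_zero_or_pos l with rfl | h
    · rw [otherNodes, Finset.sum_range_one]
      simp [Finset.erase_eq_of_notMem, hl.symm]
    · rw [show 0 + 1 - l = 0 by omega]; simp
  | succ L ih =>
    rw [otherNodes_succ, Multiset.map_add, Multiset.prod_add]
    by_cases h : l ≤ L + 1
    · rw [show L + 1 + 1 - l = L + 1 - l + 1 by omega, pow_succ]
      exact mul_dvd_mul ih (Finset.dvd_prod_of_mem (fun l : ℕ => Polynomial.X - Polynomial.C (l : ℂ))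
        (by simp; omega))
    · rw [show L + 1 + 1 - l = 0 by omega]; simp

theorem prod_range_sub_eq_factorial (k : ℕ) : ∏ l ∈ Finset.range k, (k - l) = k.factorial := by
  rw [← Finset.prod_range_add_one_eq_factorial, ← Finset.prod_range_reflect]
  refine Finset.prod_congr rfl fun l hl => ?_
  rw [Finset.mem_range] at hl
  omega

theorem prod_erase_norm_natCast_sub (k t : ℕ) :
    ∏ l ∈ (Finset.range (k + t + 1)).erase k, ‖(k : ℂ) - l‖ = k.factorial * t.factorial := by
  induction t with
  | zero =>
    rw [add_zero, Finset.range_add_one, Finset.erase_insert (by simp),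
      ← prod_range_sub_eq_factorial]
    push_cast [Nat.factorial_zero]
    rw [mul_one]
    refine Finset.prod_congr rfl fun l hl => ?_
    rw [Finset.mem_range] at hl
    rw [← Nat.cast_sub hl.le, Complex.norm_natCast]
  | succ t ih =>
    rw [show k + (t + 1) + 1 = (k + t + 1) + 1 by ring, Finset.range_add_one,
      Finset.erase_insert_of_ne (by omega), Finset.prod_insert (by simp), ih,
      norm_sub_rev, ← Nat.cast_sub (by omega), Complex.norm_natCast, Nat.factorial_succ,
      show k + t + 1 - k = t + 1 by omega]
    push_cast
    ring

theorem factorial_le_prod_dist (r k : ℕ) :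
    (∏ l ∈ (Finset.range (r + 1)).erase k, (1 + l : ℝ)) * (if k ≤ r then 1 + (k : ℝ) else 1)
      ≤ 4 ^ r * ∏ l ∈ (Finset.range (r + 1)).erase k, ‖(k : ℂ) - l‖ := by
  have hf : ∏ l ∈ Finset.range (r + 1), (1 + l : ℝ) = (r + 1).factorial := by
    rw [← Finset.prod_range_add_one_eq_factorial]
    push_cast
    exact Finset.prod_congr rfl fun l _ => add_comm _ _
  split_ifs with h
  · rw [Finset.prod_erase_mul _ (fun l : ℕ => (1 + l : ℝ)) (by simp; omega), hf]
    obtain ⟨t, rfl⟩ := Nat.exists_eq_add_of_le h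
    rw [prod_erase_norm_natCast_sub]
    have h1 : k + t + 1 ≤ 2 ^ (k + t) := Nat.lt_two_pow_self
    have h2 := Nat.choose_le_two_pow (k + t) t
    have h3 : (k + t + 1).factorial ≤ 4 ^ (k + t) * (k.factorial * t.factorial) := by
      rw [Nat.factorial_succ, ← Nat.add_choose_mul_factorial_mul_factorial, mul_assoc, ← mul_assoc,
        show 4 = 2 * 2 by rfl, mul_pow]
      exact Nat.mul_le_mul (Nat.mul_le_mul h1 h2) le_rfl
    exact_mod_cast h3
  · rw [Finset.erase_eq_of_notMem (by simp; omega), mul_one, hf, ← prod_range_sub_eq_factorial]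
    push_cast
    refine le_trans ?_ (le_mul_of_one_le_left (by positivity) (one_le_pow₀ (by norm_num)))
    refine Finset.prod_le_prod (fun _ _ => by positivity) fun l hl => ?_
    rw [Finset.mem_range] at hl
    rw [← Nat.cast_sub (by omega), Complex.norm_natCast]
    exact_mod_cast Nat.sub_le_sub_right (by omega) l

theorem otherNodes_prod_le (L k : ℕ) :
    ((otherNodes L k).map fun l : ℕ => (1 + l : ℝ)).prod * (1 + (k : ℝ)) ^ (L + 1 - k)
      ≤ 4 ^ (∑ r ∈ Finset.range (L + 1), r) *
        ((otherNodes L k).map fun l : ℕ => ‖(k : ℂ) - l‖).prod := by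
  induction L with
  | zero =>
    have := factorial_le_prod_dist 0 k
    simp only [otherNodes, Finset.sum_range_one, zero_add, Finset.prod_map_val] at this ⊢
    convert this using 2
    split_ifs with h
    · simp at h; simp [h]
    · rw [show 1 - k = 0 by omega, pow_zero]
  | succ L ih =>
    rw [otherNodes_succ, Finset.sum_range_succ, pow_add]
    simp only [Multiset.map_add, Multiset.prod_add, Finset.prod_map_val]
    have := mul_le_mul ih (factorial_le_prod_dist (L + 1) k) (by positivity) (by
      refine mul_nonneg (by positivity) (Multiset.prod_nonneg ?_)
      simp only [Multiset.mem_map]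
      rintro _ ⟨_, -, rfl⟩
      positivity)
    have e : (1 + (k : ℝ)) ^ (L + 1 + 1 - k)
        = (1 + (k : ℝ)) ^ (L + 1 - k) * (if k ≤ L + 1 then 1 + (k : ℝ) else 1) := by
      split_ifs with h
      · rw [← pow_succ]; congr 1; omega
      · rw [mul_one]; congr 1; omega
    rw [e]
    linarith

/-- The operator `f ↦ df/dX + k f`, which describes `d/dt` on the coefficient of `e ^ (k t)`. -/
noncomputable def shiftD (k : ℕ) : Module.End ℂ (Polynomial ℂ) :=
  Polynomial.derivative + algebraMap ℂ (Module.End ℂ (Polynomial ℂ)) k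

/-- The functional `p ↦ η ^ k * (p(d/dX + k) R)(ξ)`. -/
noncomputable def localFunctional (ξ η : ℂ) (k : ℕ) (R : Polynomial ℂ) : Polynomial ℂ →ₗ[ℂ] ℂ :=
  (η ^ k • Polynomial.leval ξ) ∘ₗ LinearMap.applyₗ R ∘ₗ
    (Polynomial.aeval (R := ℂ) (shiftD k)).toLinearMap

theorem localFunctional_apply (ξ η : ℂ) (k : ℕ) (R p : Polynomial ℂ) :
    localFunctional ξ η k R p = η ^ k * (Polynomial.aeval (shiftD k) p R).eval ξ := rfl

theorem aeval_shiftD_X_sub_C_pow (k m : ℕ) (R : Polynomial ℂ) :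
    Polynomial.aeval (shiftD k) ((Polynomial.X - Polynomial.C (k : ℂ)) ^ m) R
      = Polynomial.derivative^[m] R := by
  rw [map_pow, map_sub, Polynomial.aeval_X, Polynomial.aeval_C, shiftD, add_sub_cancel_right,
    Module.End.pow_apply]

theorem localFunctional_eq_zero (ξ η : ℂ) (k : ℕ) {R : Polynomial ℂ} {m : ℕ} (hR : R.degree < m)
    {p : Polynomial ℂ} (hp : (Polynomial.X - Polynomial.C (k : ℂ)) ^ m ∣ p) :
    localFunctional ξ η k R p = 0 := by
  obtain ⟨q, rfl⟩ := hp
  rw [localFunctional_apply, mul_comm _ q, map_mul, Module.End.mul_apply, aeval_shiftD_X_sub_C_pow,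
    Polynomial.iterate_derivative_eq_zero_of_degree_lt hR, map_zero, Polynomial.eval_zero, mul_zero]

/-- The length of a univariate polynomial is controlled by its derivatives at `ξ`. -/
theorem sum_norm_coeff_le (ξ : ℂ) {R : Polynomial ℂ} {m : ℕ} (hR : R.degree < m) :
    ∑ i ∈ Finset.range m, ‖R.coeff i‖ ≤
      ∑ j ∈ Finset.range m, (1 + ‖ξ‖) ^ j * ‖(Polynomial.derivative^[j] R).eval ξ‖ := by
  rcases eq_or_ne R 0 with rfl | h0
  · simp
  have ht : R = ∑ j ∈ Finset.range m,
      Polynomial.C ((Polynomial.taylor ξ R).coeff j) * (Polynomial.X + Polynomial.C (-ξ)) ^ j := by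
    conv_lhs => rw [← Polynomial.sum_taylor_eq R ξ]
    rw [Polynomial.sum_over_range' _ (by simp) m]
    · simp [sub_eq_add_neg]
    · rwa [Polynomial.natDegree_taylor, Polynomial.natDegree_lt_iff_degree_lt h0]
  have hd (j : ℕ) : ‖(Polynomial.taylor ξ R).coeff j‖ ≤ ‖(Polynomial.derivative^[j] R).eval ξ‖ := by
    have hf : (1 : ℝ) ≤ j.factorial := by exact_mod_cast Nat.one_le_iff_ne_zero.2 j.factorial_ne_zero
    rw [Polynomial.taylor_coeff, ← Polynomial.factorial_smul_hasseDeriv]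
    change _ ≤ ‖Polynomial.eval ξ (j.factorial • Polynomial.hasseDeriv j R)‖
    rw [Polynomial.eval_smul, nsmul_eq_mul, norm_mul, Complex.norm_natCast]
    exact le_mul_of_one_le_left (norm_nonneg _) hf
  have hc (i : ℕ) : ‖R.coeff i‖ ≤ ∑ j ∈ Finset.range m,
      ‖(Polynomial.taylor ξ R).coeff j‖ * (‖ξ‖ ^ (j - i) * j.choose i) := by
    conv_lhs => rw [ht]
    rw [Polynomial.finsetSum_coeff]
    refine (norm_sum_le _ _).trans (Finset.sum_le_sum fun j _ => ?_)
    rw [Polynomial.coeff_C_mul, Polynomial.coeff_X_add_C_pow]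
    simp
  refine (Finset.sum_le_sum fun i _ => hc i).trans ?_
  rw [Finset.sum_comm]
  refine Finset.sum_le_sum fun j hj => ?_
  rw [← Finset.mul_sum, mul_comm]
  refine mul_le_mul (le_of_eq ?_) (hd j) (norm_nonneg _) (by positivity)
  rw [add_pow]
  symm
  refine Finset.sum_subset_zero_on_sdiff (Finset.range_subset_range.2 (Finset.mem_range.1 hj)) ?_ ?_
  · intro i hi
    simp at hi
    rw [Nat.choose_eq_zero_of_lt (by omega)]; simp
  · intro i _; simp

/-- The interpolation estimate, for one node `k`. -/
theorem sum_norm_coeff_le_of_interpolation (ξ η : ℂ) (hη : η ≠ 0) (L : ℕ) (R : ℕ → Polynomial ℂ)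
    (hR : ∀ k, (R k).degree < (L + 1 - k : ℕ)) {A : ℝ}
    (h : ∀ i < (L + 2).choose 2, ‖∑ l ∈ Finset.range (L + 1),
      localFunctional ξ η l (R l) (Polynomial.X ^ i)‖ ≤ A) (k : ℕ) (hk : k ≤ L) :
    ∑ j ∈ Finset.range (L + 1 - k), ‖(R k).coeff j‖ ≤
      (2 + ‖ξ‖ + ‖η‖⁻¹) ^ L * (4 ^ (∑ r ∈ Finset.range (L + 1), r) * 2 ^ (L + 2).choose 2 * A) := by
  set m := L + 1 - k with hm
  set M := (L + 2).choose 2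
  set N := ∑ r ∈ Finset.range (L + 1), r
  set s := otherNodes L k with hs
  set W := (s.map fun l : ℕ => Polynomial.X - Polynomial.C (l : ℂ)).prod
  set D := (s.map fun l : ℕ => ‖(k : ℂ) - l‖).prod with hD
  set c := 2 + ‖ξ‖ + ‖η‖⁻¹ with hc
  have hcard : s.card + m = M := card_otherNodes L k
  have hA : 0 ≤ A := (norm_nonneg _).trans (h 0 (by omega))
  have hdist : ∀ l ∈ s, 1 ≤ ‖(k : ℂ) - (l : ℂ)‖ := by
    intro l hl
    have hne : (k : ℤ) - l ≠ 0 := by have := ne_of_mem_otherNodes hl; omega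
    have := Int.one_le_abs hne
    have e : (k : ℂ) - l = (((k : ℤ) - l : ℤ) : ℂ) := by push_cast; ring
    rw [e, Complex.norm_intCast]
    exact_mod_cast this
  have hDpos : 0 < D := by
    refine Multiset.prod_pos ?_
    simp only [Multiset.mem_map]
    rintro _ ⟨l, hl, rfl⟩
    linarith [hdist l hl]
  set μ := localFunctional ξ η k (R k)
  have hμ : ∀ q, μ ((Polynomial.X - Polynomial.C (k : ℂ)) ^ m * q) = 0 := fun q =>
    localFunctional_eq_zero ξ η k (hR k) (dvd_mul_right _ _)
  set S := ∑ l ∈ Finset.range (L + 1), localFunctional ξ η l (R l) with hS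
  have hSμ (q : Polynomial ℂ) : S (q * W) = μ (q * W) := by
    rw [hS, LinearMap.sum_apply]
    refine Finset.sum_eq_single_of_mem k (by simp; omega) fun l _ hl => ?_
    exact localFunctional_eq_zero ξ η l (hR l)
      ((X_sub_C_pow_dvd_otherNodes_prod L k l hl).mul_left q)
  have hglob : ∀ j < m, ‖μ ((Polynomial.X - Polynomial.C (k : ℂ)) ^ j * W)‖ ≤
      4 ^ N * D * A / 2 * 2 ^ (m - j) := by
    intro j hj
    have := norm_apply_multiset_prod_le S (A := A) (M := M)
      (fun i hi => by rw [hS, LinearMap.sum_apply]; exact h i hi)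
      (Multiset.replicate j k + s) (by simp; omega)
    simp only [Multiset.map_add, Multiset.prod_add, Multiset.map_replicate,
      Multiset.prod_replicate] at this
    rw [hSμ] at this
    refine this.trans ?_
    have h1 : (1 + (k : ℝ)) ^ j ≤ (1 + (k : ℝ)) ^ m := pow_le_pow_right₀ (by simp) hj.le
    have h2 := otherNodes_prod_le L k
    have h3 : (0 : ℝ) ≤ (s.map fun l : ℕ => (1 + l : ℝ)).prod := by
      refine Multiset.prod_nonneg ?_
      simp only [Multiset.mem_map]
      rintro _ ⟨_, -, rfl⟩
      positivity
    have h4 : (2 : ℝ) ≤ 2 ^ (m - j) := le_self_pow₀ (by norm_num) (by omega)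
    calc _ ≤ (1 + (k : ℝ)) ^ m * (s.map fun l : ℕ => (1 + l : ℝ)).prod * A := by gcongr
      _ ≤ 4 ^ N * D * A := by rw [mul_comm (_ ^ m)]; gcongr
      _ = 4 ^ N * D * A / 2 * 2 := by ring
      _ ≤ _ := by gcongr
  have hloc := norm_apply_X_sub_C_pow_le μ hμ s hdist (by positivity) hglob
  have hder (j : ℕ) (hj : j < m) : ‖η‖ ^ k * ‖(Polynomial.derivative^[j] (R k)).eval ξ‖ ≤
      4 ^ N * A * 2 ^ (M - 1 - j) := by
    have := hloc j hj
    rw [localFunctional_apply, aeval_shiftD_X_sub_C_pow, norm_mul, norm_pow, ← hD] at this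
    have e : (2 : ℝ) ^ s.card * (4 ^ N * D * A / 2) * 2 ^ (m - j)
        = D * (4 ^ N * A * 2 ^ (M - 1 - j)) := by
      rw [show (M - 1 - j) = s.card + (m - j - 1) by omega, pow_add,
        show m - j = (m - j - 1) + 1 by omega, pow_succ, Nat.add_sub_cancel]
      ring
    rw [e] at this
    exact le_of_mul_le_mul_left this hDpos
  have hηpos : 0 < ‖η‖ := norm_pos_iff.2 hη
  have hc1 : 1 + ‖ξ‖ ≤ c := by rw [hc]; linarith [inv_pos.2 hηpos]
  have hc2 : ‖η‖⁻¹ ≤ c := by rw [hc]; linarith [norm_nonneg ξ]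
  have hc0 : 1 ≤ c := by linarith [norm_nonneg ξ]
  refine (sum_norm_coeff_le ξ (hR k)).trans ?_
  have hgeom : ∑ j ∈ Finset.range m, (2 : ℝ) ^ (M - 1 - j) ≤ 2 ^ M := by
    have h1 : ∑ j ∈ Finset.range m, (2 : ℝ) ^ (M - 1 - j) ≤
        ∑ j ∈ Finset.range M, (2 : ℝ) ^ (M - 1 - j) :=
      Finset.sum_le_sum_of_subset_of_nonneg (Finset.range_subset_range.2 (by omega))
        fun _ _ _ => by positivity
    rw [Finset.sum_range_reflect (fun j => (2 : ℝ) ^ j), geom_sum_eq (by norm_num)] at h1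
    linarith
  calc _ ≤ ∑ j ∈ Finset.range m, c ^ L * (4 ^ N * A * 2 ^ (M - 1 - j)) := by
        refine Finset.sum_le_sum fun j hj => ?_
        rw [Finset.mem_range] at hj
        have h1 : ‖(Polynomial.derivative^[j] (R k)).eval ξ‖ ≤
            ‖η‖⁻¹ ^ k * (4 ^ N * A * 2 ^ (M - 1 - j)) := by
          rw [inv_pow, ← div_eq_inv_mul, le_div_iff₀ (by positivity), mul_comm]
          exact hder j hj
        calc _ ≤ c ^ j * (c ^ k * (4 ^ N * A * 2 ^ (M - 1 - j))) := by
              refine mul_le_mul (by gcongr) (h1.trans ?_) (norm_nonneg _) (by positivity)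
              gcongr
          _ = c ^ (j + k) * (4 ^ N * A * 2 ^ (M - 1 - j)) := by ring
          _ ≤ _ := by
              gcongr
              omega
    _ = c ^ L * (4 ^ N * A * ∑ j ∈ Finset.range m, (2 : ℝ) ^ (M - 1 - j)) := by
        rw [← Finset.mul_sum, ← Finset.mul_sum]
    _ ≤ c ^ L * (4 ^ N * A * 2 ^ M) := by gcongr
    _ = _ := by ring

/-- The substitution `X₀ ↦ 1`, `X₁ ↦ X`, `X₂ ↦ Y` into `ℂ[X][Y]`. -/
noncomputable def dehomog : MvPolynomial (Fin 3) ℂ →ₐ[ℂ] Polynomial (Polynomial ℂ) :=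
  aeval ![1, Polynomial.C Polynomial.X, Polynomial.X]

theorem dehomog_monomial (v : Fin 3 →₀ ℕ) (c : ℂ) :
    dehomog (monomial v c) = Polynomial.monomial (v 2) (Polynomial.monomial (v 1) c) := by
  rw [dehomog, aeval_monomial, Finsupp.prod_fintype _ _ (by simp), Fin.prod_univ_three,
    ← Polynomial.C_mul_X_pow_eq_monomial, ← Polynomial.C_mul_X_pow_eq_monomial]
  simp [mul_assoc]

theorem coeff_dehomog_DD (P : MvPolynomial (Fin 3) ℂ) (k : ℕ) :
    (dehomog (DD P)).coeff k = shiftD k ((dehomog P).coeff k) := by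
  induction P using MvPolynomial.induction_on' with
  | add P Q hP hQ =>
    have : DD (P + Q) = DD P + DD Q := by simp only [DD, map_add]; ring
    rw [this]; simp [hP, hQ]
  | monomial v c =>
    have h0 : dehomog (X 0) = 1 := by simp [dehomog]
    have h2 : dehomog (X 2) = Polynomial.X := by simp [dehomog]
    rw [DD, map_add, map_mul, map_mul, h0, h2, pderiv_monomial, pderiv_monomial]
    simp only [dehomog_monomial, shiftD, LinearMap.add_apply, Module.algebraMap_end_apply, one_mul,
      Polynomial.coeff_add]
    congr 1
    · simp only [Polynomial.coeff_monomial]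
      split_ifs <;> simp_all [Polynomial.derivative_monomial]
    · cases k with
      | zero => simp
      | succ k =>
        rw [Polynomial.coeff_X_mul, Polynomial.coeff_monomial, Polynomial.coeff_monomial]
        rcases Nat.eq_zero_or_pos (v 2) with h | h
        · simp [h]
        · by_cases hk : v 2 = k + 1
          · simp [hk, Polynomial.smul_monomial, mul_comm]
          · rw [if_neg (by simp; omega), if_neg hk, smul_zero]

theorem eval_eq_eval_dehomog (ξ η : ℂ) (P : MvPolynomial (Fin 3) ℂ) :
    eval ![1, ξ, η] P = (dehomog P).evalEval ξ η := by
  induction P using MvPolynomial.induction_on' with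
  | add P Q hP hQ => simp [hP, hQ]
  | monomial v c =>
    rw [dehomog_monomial, eval_monomial, Finsupp.prod_fintype _ _ (by simp), Fin.prod_univ_three]
    simp [Polynomial.evalEval, mul_assoc]

theorem coeff_dehomog_iterate_DD (P : MvPolynomial (Fin 3) ℂ) (i k : ℕ) :
    (dehomog (DD^[i] P)).coeff k =
      Polynomial.aeval (shiftD k) (Polynomial.X ^ i : Polynomial ℂ) ((dehomog P).coeff k) := by
  rw [map_pow, Polynomial.aeval_X, Module.End.pow_apply]
  induction i with
  | zero => rfl
  | succ i ih => rw [Function.iterate_succ_apply', Function.iterate_succ_apply', coeff_dehomog_DD, ih]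

theorem eval_iterate_DD (ξ η : ℂ) {L : ℕ} {P : MvPolynomial (Fin 3) ℂ}
    (hP : ∀ k, L < k → (dehomog P).coeff k = 0) (i : ℕ) :
    eval ![1, ξ, η] (DD^[i] P) = ∑ k ∈ Finset.range (L + 1),
      localFunctional ξ η k ((dehomog P).coeff k) (Polynomial.X ^ i) := by
  have hdeg : (dehomog (DD^[i] P)).natDegree < L + 1 := by
    rw [Nat.lt_succ_iff, Polynomial.natDegree_le_iff_coeff_eq_zero]
    intro k hk
    rw [coeff_dehomog_iterate_DD, hP k hk, map_zero]
  rw [eval_eq_eval_dehomog, Polynomial.evalEval, Polynomial.eval_eq_sum_range' hdeg,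
    Polynomial.eval_finsetSum]
  refine Finset.sum_congr rfl fun k _ => ?_
  rw [localFunctional_apply, coeff_dehomog_iterate_DD]
  simp [mul_comm]

theorem coeff_coeff_dehomog (P : MvPolynomial (Fin 3) ℂ) (k j : ℕ) :
    ((dehomog P).coeff k).coeff j =
      ∑ v ∈ P.support, if v 2 = k ∧ v 1 = j then P.coeff v else 0 := by
  conv_lhs => rw [P.as_sum]
  rw [map_sum, Polynomial.finsetSum_coeff, Polynomial.finsetSum_coeff]
  refine Finset.sum_congr rfl fun v _ => ?_
  rw [dehomog_monomial, Polynomial.coeff_monomial]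
  split_ifs with h1 h2 h2
  · simp [h2.2]
  · rw [Polynomial.coeff_monomial, if_neg fun h => h2 ⟨h1, h⟩]
  · exact absurd h2.1 h1
  · simp

theorem MvPolynomial.IsHomogeneous.sum_eq_of_mem_support {P : MvPolynomial (Fin 3) ℂ} {L : ℕ}
    (hP : P.IsHomogeneous L) {v : Fin 3 →₀ ℕ} (hv : v ∈ P.support) : v 0 + v 1 + v 2 = L := by
  have h : v.degree = L := by
    rw [Finsupp.degree_eq_weight_one]
    exact hP (mem_support_iff.1 hv)
  rwa [Finsupp.degree_eq_sum, Fin.sum_univ_three] at h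

theorem degree_coeff_dehomog_lt {P : MvPolynomial (Fin 3) ℂ} {L : ℕ} (hP : P.IsHomogeneous L)
    (k : ℕ) : ((dehomog P).coeff k).degree < (L + 1 - k : ℕ) := by
  rw [Polynomial.degree_lt_iff_coeff_zero]
  intro j hj
  rw [coeff_coeff_dehomog]
  refine Finset.sum_eq_zero fun v hv => if_neg ?_
  have := hP.sum_eq_of_mem_support hv
  omega

theorem coeff_coeff_dehomog_of_mem_support {P : MvPolynomial (Fin 3) ℂ} {L : ℕ}
    (hP : P.IsHomogeneous L) {v : Fin 3 →₀ ℕ} (hv : v ∈ P.support) :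
    ((dehomog P).coeff (v 2)).coeff (v 1) = P.coeff v := by
  rw [coeff_coeff_dehomog, Finset.sum_eq_single_of_mem v hv, if_pos ⟨rfl, rfl⟩]
  rintro w hw hwv
  refine if_neg fun h => hwv ?_
  have h1 := hP.sum_eq_of_mem_support hv
  have h2 := hP.sum_eq_of_mem_support hw
  ext i
  fin_cases i <;> simp <;> omega

theorem plen_le_sum {P : MvPolynomial (Fin 3) ℂ} {L : ℕ} (hP : P.IsHomogeneous L) :
    plen P ≤ ∑ k ∈ Finset.range (L + 1), ∑ j ∈ Finset.range (L + 1 - k),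
      ‖((dehomog P).coeff k).coeff j‖ := by
  rw [Finset.sum_sigma', plen]
  have hinj : Set.InjOn (fun v : Fin 3 →₀ ℕ => (⟨v 2, v 1⟩ : Σ _ : ℕ, ℕ)) P.support := by
    intro v hv w hw hvw
    have h1 := hP.sum_eq_of_mem_support hv
    have h2 := hP.sum_eq_of_mem_support hw
    simp only [Sigma.mk.injEq, heq_eq_eq] at hvw
    ext i
    fin_cases i <;> simp <;> omega
  calc ∑ v ∈ P.support, ‖P.coeff v‖
      = ∑ v ∈ P.support, ‖((dehomog P).coeff (v 2)).coeff (v 1)‖ :=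
        Finset.sum_congr rfl fun v hv => by rw [coeff_coeff_dehomog_of_mem_support hP hv]
    _ = ∑ x ∈ P.support.image (fun v : Fin 3 →₀ ℕ => (⟨v 2, v 1⟩ : Σ _ : ℕ, ℕ)),
          ‖((dehomog P).coeff x.1).coeff x.2‖ := 
          (Finset.sum_image (f := fun x : Σ _ : ℕ, ℕ => ‖((dehomog P).coeff x.1).coeff x.2‖) hinj).symm
    _ ≤ _ := by
        refine Finset.sum_le_sum_of_subset_of_nonneg ?_ fun _ _ _ => norm_nonneg _
        intro x hx
        obtain ⟨v, hv, rfl⟩ := Finset.mem_image.1 hx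
        have := hP.sum_eq_of_mem_support hv
        simp only [Finset.mem_sigma, Finset.mem_range]
        omega

theorem plen_le (ξ η : ℂ) (hη : η ≠ 0) (L : ℕ) {Q : MvPolynomial (Fin 3) ℂ}
    (hQ : Q.IsHomogeneous L) {A : ℝ}
    (hA : ∀ i < (L + 2).choose 2, ‖eval ![1, ξ, η] (DD^[i] Q)‖ ≤ A) :
    plen Q ≤ (2 + ‖ξ‖ + ‖η‖⁻¹) ^ L * 8 ^ (L + 2).choose 2 * A := by
  have hM0 : 0 < (L + 2).choose 2 := Nat.choose_pos (by omega)
  have hA0 : 0 ≤ A := (norm_nonneg _).trans (hA 0 hM0)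
  have hR := degree_coeff_dehomog_lt hQ
  have h0 (k : ℕ) (hk : L < k) : (dehomog Q).coeff k = 0 := by
    have := hR k
    rw [show L + 1 - k = 0 by omega] at this
    simpa using this
  refine (plen_le_sum hQ).trans ((Finset.sum_le_sum fun k hk =>
    sum_norm_coeff_le_of_interpolation ξ η hη L _ hR
      (fun i hi => by rw [← eval_iterate_DD ξ η h0]; exact hA i hi) k
      (Nat.lt_succ_iff.1 (Finset.mem_range.1 hk))).trans ?_)
  have hsum : ∑ r ∈ Finset.range (L + 1), r + (L + 1) = (L + 2).choose 2 := by
    rw [← Finset.sum_range_succ (fun r => r), Finset.sum_range_id, Nat.choose_two_right]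
  have hL : ((L + 1 : ℕ) : ℝ) ≤ 4 ^ (L + 1) := by
    exact_mod_cast (Nat.lt_pow_self (by norm_num)).le
  rw [Finset.sum_const, Finset.card_range, nsmul_eq_mul]
  calc _ ≤ 4 ^ (L + 1) * ((2 + ‖ξ‖ + ‖η‖⁻¹) ^ L *
        (4 ^ (∑ r ∈ Finset.range (L + 1), r) * 2 ^ (L + 2).choose 2 * A)) := by gcongr
    _ = (2 + ‖ξ‖ + ‖η‖⁻¹) ^ L * (4 ^ (∑ r ∈ Finset.range (L + 1), r + (L + 1)) *
        2 ^ (L + 2).choose 2) * A := by ring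
    _ = _ := by rw [hsum, ← mul_pow]; norm_num

theorem choose_le_finrank_homogeneousSubmodule (L : ℕ) :
    (L + 2).choose 2 ≤ Module.finrank ℂ (homogeneousSubmodule (Fin 3) ℂ L) := by
  have := Module.Finite.iff_fg.2 (homogeneousSubmodule_fg (σ := Fin 3) (R := ℂ) L)
  let b (v : Finset.finsuppAntidiag (Finset.univ : Finset (Fin 3)) L) :
      homogeneousSubmodule (Fin 3) ℂ L :=
    ⟨monomial v 1, isHomogeneous_monomial _ (by
      rw [Finsupp.degree_eq_sum]; exact (Finset.mem_finsuppAntidiag.1 v.2).1)⟩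
  have hb : LinearIndependent ℂ b := by
    refine LinearIndependent.of_comp (homogeneousSubmodule (Fin 3) ℂ L).subtype ?_
    have := (basisMonomials (Fin 3) ℂ).linearIndependent.comp
      (fun v : Finset.finsuppAntidiag (Finset.univ : Finset (Fin 3)) L => (v : Fin 3 →₀ ℕ))
      Subtype.val_injective
    rw [coe_basisMonomials] at this
    exact this
  have h := hb.fintype_card_le_finrank
  rw [Fintype.card_coe, Finset.card_finsuppAntidiag_nat_eq_choose, Finset.card_univ,
    Fintype.card_fin] at h
  rwa [show 3 + L - 1 = L + 2 by omega, Nat.choose_symm_add] at h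

theorem isLinearMap_DD : IsLinearMap ℂ DD where
  map_add P Q := by simp only [DD, map_add]; ring
  map_smul c P := by simp only [DD, Derivation.map_smul, smul_add, mul_smul_comm]

theorem stmt3 (ξ η : ℂ) (hη : η ≠ 0) (L M : ℕ) (hM : M = Nat.choose (L + 2) 2) :
    Function.Bijective (fun Q : homogeneousSubmodule (Fin 3) ℂ L =>
      fun i : Fin M => eval ![1, ξ, η] (DD^[(i : ℕ)] (Q : MvPolynomial (Fin 3) ℂ))) ∧
    ∀ Q : MvPolynomial (Fin 3) ℂ, Q.IsHomogeneous L →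
      ∃ i < M, plen Q ≤ (2 + ‖ξ‖ + ‖η‖⁻¹) ^ L * 8 ^ M * ‖eval ![1, ξ, η] (DD^[i] Q)‖ := by
  subst hM
  constructor
  · have := Module.Finite.iff_fg.2 (homogeneousSubmodule_fg (σ := Fin 3) (R := ℂ) L)
    let φ : homogeneousSubmodule (Fin 3) ℂ L →ₗ[ℂ] (Fin ((L + 2).choose 2) → ℂ) :=
      LinearMap.pi fun i => (aeval (R := ℂ) ![1, ξ, η]).toLinearMap ∘ₗ
        (isLinearMap_DD.mk' DD ^ (i : ℕ)) ∘ₗ (homogeneousSubmodule (Fin 3) ℂ L).subtype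
    have hφ (Q : homogeneousSubmodule (Fin 3) ℂ L) : φ Q = fun i : Fin ((L + 2).choose 2) =>
        eval ![1, ξ, η] (DD^[(i : ℕ)] (Q : MvPolynomial (Fin 3) ℂ)) := by
      funext i
      simp only [φ, LinearMap.pi_apply, LinearMap.comp_apply, Module.End.pow_apply]
      simp [aeval_eq_eval]
      rfl
    have hinj : Function.Injective φ := by
      rw [injective_iff_map_eq_zero]
      intro Q hQ
      have hp := plen_le ξ η hη L Q.2 (A := 0) fun i hi => by
        have := congrFun ((hφ Q).symm.trans hQ) ⟨i, hi⟩
        simp only [Pi.zero_apply] at this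
        rw [this, norm_zero]
      rw [mul_zero, plen] at hp
      have h0 := (Finset.sum_eq_zero_iff_of_nonneg fun _ _ => norm_nonneg _).1
        (le_antisymm hp (Finset.sum_nonneg fun _ _ => norm_nonneg _))
      ext v
      by_contra hv
      exact hv (norm_eq_zero.1 (h0 v (mem_support_iff.2 hv)))
    have hrank : Module.finrank ℂ (homogeneousSubmodule (Fin 3) ℂ L)
        = Module.finrank ℂ (Fin ((L + 2).choose 2) → ℂ) := by
      refine le_antisymm (LinearMap.finrank_le_finrank_of_injective hinj) ?_
      rw [Module.finrank_fin_fun]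
      exact choose_le_finrank_homogeneousSubmodule L
    have hbij : Function.Bijective φ :=
      ⟨hinj, (LinearMap.injective_iff_surjective_of_finrank_eq_finrank hrank).1 hinj⟩
    rwa [show ⇑φ = _ from funext hφ] at hbij
  · intro Q hQ
    obtain ⟨i, hi, hmax⟩ := Finset.exists_max_image (Finset.range ((L + 2).choose 2))
      (fun i => ‖eval ![1, ξ, η] (DD^[i] Q)‖)
      (Finset.nonempty_range_iff.2 (Nat.choose_pos (by omega)).ne')
    exact ⟨i, Finset.mem_range.1 hi,
      plen_le ξ η hη L hQ fun j hj => hmax j (Finset.mem_range.2 hj)⟩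
end

section
/- Let γ = (ξ,η) ∈ 𝒢 and T ∈ ℕ*. Define I_γ = I^{(γ,1)}, the ideal of ℂ[X] generated by the homogeneous polynomials vanishing at (1,ξ,η). Then I_γ is a prime ideal of height 2, the ideal I^{(γ,T)} is I_γ-primary, and for every integer D with C(D+2,2) ≥ T the ℂ-dimension of ℂ[X]_D / I^{(γ,T)}_D equals T (i.e. I^{(γ,T)} has degree T). -/
open MvPolynomial

/-- The derivation `X₀·∂/∂X₁ + X₂·∂/∂X₂` bundled as a derivation of `ℂ[X₀,X₁,X₂]`. -/
noncomputable def ddDerivation :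
    Derivation ℂ (MvPolynomial (Fin 3) ℂ) (MvPolynomial (Fin 3) ℂ) :=
  (X 0 : MvPolynomial (Fin 3) ℂ) • pderiv 1 + (X 2 : MvPolynomial (Fin 3) ℂ) • pderiv 2

theorem coe_ddDerivation : ⇑ddDerivation = DD := by
  funext P
  simp [ddDerivation, DD]

theorem DD_isHomogeneous {P : MvPolynomial (Fin 3) ℂ} {d : ℕ} (hP : P.IsHomogeneous d) :
    (DD P).IsHomogeneous d := by
  rcases d with _ | d
  · have h : P = C (coeff 0 P) :=
      totalDegree_eq_zero_iff_eq_C.mp (Nat.le_zero.mp hP.totalDegree_le)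
    rw [h, ← coe_ddDerivation]
    simpa [ddDerivation] using isHomogeneous_zero (Fin 3) ℂ 0
  · have h (i j : Fin 3) : (X i * pderiv j P).IsHomogeneous (d + 1) := by
      rw [add_comm]
      exact (isHomogeneous_X ℂ i).mul hP.pderiv
    exact (h 0 1).add (h 2 2)

theorem DD_iterate_isHomogeneous {P : MvPolynomial (Fin 3) ℂ} {d : ℕ} (hP : P.IsHomogeneous d)
    (i : ℕ) : (DD^[i] P).IsHomogeneous d := by
  induction i with
  | zero => exact hP
  | succ i ih =>
    rw [Function.iterate_succ_apply']
    exact DD_isHomogeneous ih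

section Eigenvectors

theorem coeff_X_two_mul_pderiv (P : MvPolynomial (Fin 3) ℂ) (m : Fin 3 →₀ ℕ) :
    coeff m (X 2 * pderiv 2 P) = m 2 * coeff m P := by
  rw [coeff_X_mul']
  split_ifs with h
  · have hle : Finsupp.single 2 1 ≤ m := by
      rw [Finsupp.single_le_iff]
      exact Nat.one_le_iff_ne_zero.mpr (Finsupp.mem_support_iff.mp h)
    obtain ⟨n, rfl⟩ := exists_add_of_le hle
    rw [add_tsub_cancel_left, coeff_pderiv, add_comm n]
    simp
    ring
  · simp [Finsupp.notMem_support_iff.mp h]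

theorem coeff_DD_of_apply_zero_eq_zero (P : MvPolynomial (Fin 3) ℂ) {m : Fin 3 →₀ ℕ}
    (hm : m 0 = 0) : coeff m (DD P) = m 2 * coeff m P := by
  rw [DD, coeff_add, coeff_X_two_mul_pderiv, coeff_X_mul']
  simp [hm]

theorem coeff_DD_add_single (P : MvPolynomial (Fin 3) ℂ) (m : Fin 3 →₀ ℕ) :
    coeff (m + Finsupp.single 0 1) (DD P) =
      coeff (m + Finsupp.single 1 1) P * (m 1 + 1) +
        m 2 * coeff (m + Finsupp.single 0 1) P := by
  rw [DD, coeff_add, coeff_X_two_mul_pderiv, add_comm m (Finsupp.single 0 1), coeff_X_mul,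
    coeff_pderiv]
  simp

variable {P : MvPolynomial (Fin 3) ℂ} {μ : ℂ}

theorem coeff_eq_zero_of_DD_eq_smul (h : DD P = μ • P) (k : ℕ) (m : Fin 3 →₀ ℕ) (hk : m 0 = k)
    (hm : (m 2 : ℂ) ≠ μ) : coeff m P = 0 := by
  induction k generalizing m with
  | zero =>
    have h1 := coeff_DD_of_apply_zero_eq_zero P hk
    rw [h, coeff_smul, smul_eq_mul] at h1
    exact (mul_eq_zero.mp (by linear_combination h1 : (μ - m 2) * coeff m P = 0)).resolve_left
      (sub_ne_zero.mpr hm.symm)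
  | succ k ih =>
    have hle : Finsupp.single 0 1 ≤ m := by
      rw [Finsupp.single_le_iff]
      omega
    obtain ⟨n, rfl⟩ := exists_add_of_le hle
    rw [add_comm] at hk hm ⊢
    have h0 : coeff (n + Finsupp.single 1 1) P = 0 := by
      apply ih
      · simpa using hk
      · simpa using hm
    have h1 := coeff_DD_add_single P n
    rw [h, coeff_smul, smul_eq_mul, h0] at h1
    have hn : (n 2 : ℂ) ≠ μ := by simpa using hm
    exact (mul_eq_zero.mp (by linear_combination h1 :
      (μ - n 2) * coeff (n + Finsupp.single 0 1) P = 0)).resolve_left (sub_ne_zero.mpr hn.symm)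

theorem apply_two_eq_of_DD_eq_smul (h : DD P = μ • P) {m : Fin 3 →₀ ℕ} (hm : coeff m P ≠ 0) :
    (m 2 : ℂ) = μ := by
  by_contra hne
  exact hm (coeff_eq_zero_of_DD_eq_smul h _ m rfl hne)

theorem apply_one_eq_zero_of_DD_eq_smul (h : DD P = μ • P) {m : Fin 3 →₀ ℕ}
    (hm : coeff m P ≠ 0) : m 1 = 0 := by
  by_contra hne
  have hle : Finsupp.single 1 1 ≤ m := by
    rw [Finsupp.single_le_iff]
    omega
  obtain ⟨n, rfl⟩ := exists_add_of_le hle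
  rw [add_comm] at hm hne
  have h2 := apply_two_eq_of_DD_eq_smul h hm
  have h1 := coeff_DD_add_single P n
  have hn : (n 2 : ℂ) = μ := by simpa using h2
  rw [h, coeff_smul, smul_eq_mul, hn, right_eq_add, mul_eq_zero] at h1
  exact h1.elim hm (by exact_mod_cast Nat.succ_ne_zero (n 1))

/-- An eigenvector of `DD` that is homogeneous is a scalar multiple of some `X₀^a X₂^b`, and
so does not vanish at `(1, ξ, η)`. -/
theorem eval_ne_zero_of_DD_eq_smul {ξ η : ℂ} (hη : η ≠ 0) {d : ℕ} (hP : P.IsHomogeneous d)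
    (h0 : P ≠ 0) (h : DD P = μ • P) : eval ![1, ξ, η] P ≠ 0 := by
  obtain ⟨m, hm⟩ := exists_coeff_ne_zero h0
  have hdeg {n : Fin 3 →₀ ℕ} (hn : coeff n P ≠ 0) : n 0 + n 1 + n 2 = d := by
    have := not_imp_comm.mp (hP.coeff_eq_zero (d := n)) hn
    rwa [Finsupp.degree_eq_sum, Fin.sum_univ_three] at this
  have hmono : P = monomial m (coeff m P) := by
    ext n
    rw [coeff_monomial]
    split_ifs with hmn
    · rw [hmn]
    · by_contra hn
      apply hmn
      have e1 := apply_one_eq_zero_of_DD_eq_smul h hm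
      have e1' := apply_one_eq_zero_of_DD_eq_smul h hn
      have e2 : m 2 = n 2 := by
        exact_mod_cast (apply_two_eq_of_DD_eq_smul h hm).trans
          (apply_two_eq_of_DD_eq_smul h hn).symm
      have e3 := hdeg hm
      have e3' := hdeg hn
      ext i
      fin_cases i <;> simp <;> omega
  rw [hmono, eval_monomial, Finsupp.prod_fintype _ _ (by simp), Fin.prod_univ_three,
    apply_one_eq_zero_of_DD_eq_smul h hm]
  simp [hm, hη]

end Eigenvectors

section Evaluation

variable (ξ η : ℂ) (D : ℕ)

/-- The restriction of `DD` to homogeneous polynomials of degree `D`. -/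
noncomputable def ddHomogeneous : Module.End ℂ (homogeneousSubmodule (Fin 3) ℂ D) :=
  ddDerivation.toLinearMap.restrict fun P hP => by
    have := DD_isHomogeneous ((mem_homogeneousSubmodule D P).mp hP)
    rw [← coe_ddDerivation] at this
    exact this

theorem coe_ddHomogeneous_pow_apply (i : ℕ) (P : homogeneousSubmodule (Fin 3) ℂ D) :
    (((ddHomogeneous D ^ i) P : homogeneousSubmodule (Fin 3) ℂ D) : MvPolynomial (Fin 3) ℂ) =
      DD^[i] P := by
  induction i with
  | zero => rfl
  | succ i ih =>
    rw [pow_succ', Function.iterate_succ_apply', ← ih, ← coe_ddDerivation]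
    rfl

/-- Evaluation at `(1, ξ, η)` as a linear form on homogeneous polynomials of degree `D`. -/
noncomputable def evalHomogeneous : homogeneousSubmodule (Fin 3) ℂ D →ₗ[ℂ] ℂ :=
  (aeval ![1, ξ, η]).toLinearMap ∘ₗ (homogeneousSubmodule (Fin 3) ℂ D).subtype

/-- The values at `(1, ξ, η)` of the first `n` iterates of `DD` on homogeneous polynomials
of degree `D`. -/
noncomputable def jetHomogeneous (n : ℕ) :
    homogeneousSubmodule (Fin 3) ℂ D →ₗ[ℂ] (Fin n → ℂ) :=
  LinearMap.pi fun i => evalHomogeneous ξ η D ∘ₗ ddHomogeneous D ^ (i : ℕ)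

theorem evalHomogeneous_ddHomogeneous_pow (i : ℕ) (P : homogeneousSubmodule (Fin 3) ℂ D) :
    evalHomogeneous ξ η D ((ddHomogeneous D ^ i) P) = eval ![1, ξ, η] (DD^[i] P.1) := by
  rw [← coe_ddHomogeneous_pow_apply, ← coe_aeval_eq_eval]
  rfl

instance : Module.Finite ℂ (homogeneousSubmodule (Fin 3) ℂ D) :=
  Module.Finite.iff_fg.mpr (homogeneousSubmodule_fg (Fin 3) ℂ D)

variable {ξ η D}

theorem eq_zero_of_forall_evalHomogeneous_eq_zero (hη : η ≠ 0)
    {P : homogeneousSubmodule (Fin 3) ℂ D}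
    (hP : ∀ i, evalHomogeneous ξ η D ((ddHomogeneous D ^ i) P) = 0) : P = 0 := by
  let W : Submodule ℂ (homogeneousSubmodule (Fin 3) ℂ D) :=
    ⨅ i, LinearMap.ker (evalHomogeneous ξ η D ∘ₗ ddHomogeneous D ^ i)
  have memW (Q) : Q ∈ W ↔ ∀ i, evalHomogeneous ξ η D ((ddHomogeneous D ^ i) Q) = 0 := by
    simp [W]
  have hW : ∀ Q ∈ W, ddHomogeneous D Q ∈ W := by
    intro Q hQ
    rw [memW] at hQ ⊢
    intro i
    have := hQ (i + 1)
    rwa [pow_succ] at this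
  have hbot : W = ⊥ := by
    by_contra hne
    have : Nontrivial W := Submodule.nontrivial_iff_ne_bot.mpr hne
    obtain ⟨μ, hμ⟩ := Module.End.exists_eigenvalue
      (K := ℂ) (V := W) (LinearMap.restrict (ddHomogeneous D) hW)
    obtain ⟨Q, hQ⟩ := hμ.exists_hasEigenvector
    have hQ' : DD Q.1.1 = μ • Q.1.1 := by
      rw [← coe_ddDerivation]
      exact congrArg (fun R : W => R.1.1) hQ.apply_eq_smul
    refine eval_ne_zero_of_DD_eq_smul (ξ := ξ) hη Q.1.2 ?_ hQ' ?_
    · intro h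
      exact hQ.2 (Subtype.ext (Subtype.ext h))
    · have := (memW _).mp Q.2 0
      rwa [evalHomogeneous_ddHomogeneous_pow] at this
  have : P ∈ W := (memW P).mpr hP
  rwa [hbot, Submodule.mem_bot] at this

theorem jetHomogeneous_finrank_injective (hη : η ≠ 0) : Function.Injective
    (jetHomogeneous ξ η D (Module.finrank ℂ (homogeneousSubmodule (Fin 3) ℂ D))) := by
  rw [← LinearMap.ker_eq_bot, LinearMap.ker_eq_bot']
  intro P hP
  apply eq_zero_of_forall_evalHomogeneous_eq_zero (ξ := ξ) hη
  intro k
  set q := (Polynomial.X ^ k : Polynomial ℂ) %ₘ (ddHomogeneous D).charpoly with hq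
  rw [LinearMap.pow_eq_aeval_mod_charpoly, ← hq, Polynomial.aeval_eq_sum_range,
    LinearMap.sum_apply, map_sum]
  refine Finset.sum_eq_zero fun i _ => ?_
  rw [LinearMap.smul_apply, map_smul]
  by_cases hi : i < Module.finrank ℂ (homogeneousSubmodule (Fin 3) ℂ D)
  · have := congrFun hP ⟨i, hi⟩
    rw [show evalHomogeneous ξ η D ((ddHomogeneous D ^ i) P) = 0 from this, smul_zero]
  · rw [Polynomial.coeff_eq_zero_of_degree_lt, zero_smul]
    refine (Polynomial.degree_modByMonic_lt _ (LinearMap.charpoly_monic _)).trans_le ?_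
    rw [Polynomial.degree_eq_natDegree (LinearMap.charpoly_monic _).ne_zero,
      LinearMap.charpoly_natDegree]
    exact_mod_cast not_lt.mp hi

theorem jetHomogeneous_surjective (hη : η ≠ 0) {n : ℕ}
    (hn : n ≤ Module.finrank ℂ (homogeneousSubmodule (Fin 3) ℂ D)) :
    Function.Surjective (jetHomogeneous ξ η D n) := by
  have hs := (LinearMap.injective_iff_surjective_of_finrank_eq_finrank (by simp)).mp
    (jetHomogeneous_finrank_injective (ξ := ξ) (D := D) hη)
  intro v
  obtain ⟨P, hP⟩ := hs fun i => if h : i.1 < n then v ⟨i, h⟩ else 0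
  refine ⟨P, funext fun i => ?_⟩
  have := congrFun hP ⟨i, i.2.trans_le hn⟩
  rwa [dif_pos i.2] at this

theorem finrank_homogeneousSubmodule (D : ℕ) :
    Module.finrank ℂ (homogeneousSubmodule (Fin 3) ℂ D) = (D + 2).choose 2 := by
  have hset : {d : Fin 3 →₀ ℕ | d.degree = D} =
      ((Finset.univ : Finset (Fin 3)).finsuppAntidiag D : Set (Fin 3 →₀ ℕ)) := by
    ext d
    simp [Finsupp.degree_eq_sum]
  rw [homogeneousSubmodule_eq_finsupp_supported, hset,
    (AddMonoidAlgebra.supportedEquivFinsupp _).finrank_eq, Module.finrank_finsupp_self]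
  simp only [Finset.coe_sort_coe, Fintype.card_coe, Finset.card_finsuppAntidiag_nat_eq_choose,
    Finset.card_univ, Fintype.card_fin]
  rw [show 3 + D - 1 = D + 2 by omega, Nat.choose_symm_add]

end Evaluation

section Jets

/-- Taylor expansion along the curve `t ↦ (s, s(ξ + t), sη·exp t)`. -/
noncomputable def jetMap (ξ η : ℂ) : MvPolynomial (Fin 3) ℂ →ₐ[ℂ] PowerSeries (Polynomial ℂ) :=
  aeval ![PowerSeries.C Polynomial.X,
    PowerSeries.C Polynomial.X * (PowerSeries.C (Polynomial.C ξ) + PowerSeries.X),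
    PowerSeries.C Polynomial.X * PowerSeries.C (Polynomial.C η) * PowerSeries.exp _]

variable (ξ η : ℂ)

theorem jetMap_C (a : ℂ) : jetMap ξ η (C a) = PowerSeries.C (Polynomial.C a) := by
  rw [algHom_C, PowerSeries.algebraMap_apply, Polynomial.algebraMap_eq]

theorem jetMap_DD (P : MvPolynomial (Fin 3) ℂ) :
    jetMap ξ η (DD P) = PowerSeries.derivative (Polynomial ℂ) (jetMap ξ η P) := by
  rw [← coe_ddDerivation]
  induction P using MvPolynomial.induction_on with
  | C a =>
    rw [jetMap_C, PowerSeries.derivative_C, ← algebraMap_eq, Derivation.map_algebraMap, map_zero]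
  | add P Q hP hQ => simp only [map_add, hP, hQ]
  | mul_X P i hP =>
    have hX : jetMap ξ η (ddDerivation (X i)) =
        PowerSeries.derivative (Polynomial ℂ) (jetMap ξ η (X i)) := by
      fin_cases i <;>
        simp [ddDerivation, jetMap, pderiv_X, PowerSeries.derivative_exp, Derivation.leibniz]
    simp only [Derivation.leibniz, map_mul, map_add, smul_eq_mul, hP, hX]

theorem jetMap_DD_iterate (P : MvPolynomial (Fin 3) ℂ) (i : ℕ) :
    jetMap ξ η (DD^[i] P) = (PowerSeries.derivative (Polynomial ℂ))^[i] (jetMap ξ η P) := by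
  induction i with
  | zero => rfl
  | succ i ih => rw [Function.iterate_succ_apply', Function.iterate_succ_apply', jetMap_DD, ih]

theorem constantCoeff_jetMap (P : MvPolynomial (Fin 3) ℂ) :
    PowerSeries.constantCoeff (jetMap ξ η P) =
      aeval ![Polynomial.X, Polynomial.C ξ * Polynomial.X, Polynomial.C η * Polynomial.X] P := by
  induction P using MvPolynomial.induction_on with
  | C a =>
    rw [jetMap_C, PowerSeries.constantCoeff_C, algHom_C, Polynomial.algebraMap_eq]
  | add P Q hP hQ => simp only [map_add, hP, hQ]
  | mul_X P i hP =>
    rw [map_mul, map_mul, map_mul, hP]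
    congr 1
    fin_cases i <;> simp [jetMap, mul_comm Polynomial.X]

theorem constantCoeff_jetMap_of_isHomogeneous {P : MvPolynomial (Fin 3) ℂ} {d : ℕ}
    (hP : P.IsHomogeneous d) : PowerSeries.constantCoeff (jetMap ξ η P) =
      Polynomial.monomial d (eval ![1, ξ, η] P) := by
  rw [constantCoeff_jetMap, aeval_def, eval₂_eq', eval_eq', map_sum]
  refine Finset.sum_congr rfl fun m hm => ?_
  have hdeg := not_imp_comm.mp (hP.coeff_eq_zero (d := m)) (mem_support_iff.mp hm)
  rw [Finsupp.degree_eq_sum, Fin.sum_univ_three] at hdeg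
  rw [← Polynomial.C_mul_X_pow_eq_monomial, ← hdeg]
  simp [Fin.prod_univ_three, Polynomial.algebraMap_eq]
  ring

theorem coeff_jetMap_of_isHomogeneous {P : MvPolynomial (Fin 3) ℂ} {d : ℕ}
    (hP : P.IsHomogeneous d) (i : ℕ) : (i.factorial : Polynomial ℂ) *
      PowerSeries.coeff i (jetMap ξ η P) = Polynomial.monomial d (eval ![1, ξ, η] (DD^[i] P)) := by
  rw [← PowerSeries.constantCoeff_iterate_derivative, ← jetMap_DD_iterate,
    constantCoeff_jetMap_of_isHomogeneous ξ η (DD_iterate_isHomogeneous hP i)]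

theorem coeff_jetMap_eq_zero_iff {P : MvPolynomial (Fin 3) ℂ} {d : ℕ}
    (hP : P.IsHomogeneous d) (i : ℕ) :
    PowerSeries.coeff i (jetMap ξ η P) = 0 ↔ eval ![1, ξ, η] (DD^[i] P) = 0 := by
  rw [← Polynomial.monomial_eq_zero_iff (eval _ _) d, ← coeff_jetMap_of_isHomogeneous ξ η hP, mul_eq_zero,
    or_iff_right (Nat.cast_ne_zero.mpr i.factorial_ne_zero)]

theorem factorial_mul_coeff_jetMap (P : MvPolynomial (Fin 3) ℂ) (i : ℕ) :
    (i.factorial : Polynomial ℂ) * PowerSeries.coeff i (jetMap ξ η P) =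
      ∑ d ∈ Finset.range (P.totalDegree + 1),
        Polynomial.monomial d (eval ![1, ξ, η] (DD^[i] (homogeneousComponent d P))) := by
  conv_lhs => rw [← sum_homogeneousComponent P]
  rw [map_sum, map_sum, Finset.mul_sum]
  exact Finset.sum_congr rfl fun d _ =>
    coeff_jetMap_of_isHomogeneous ξ η (homogeneousComponent_isHomogeneous d P) i

theorem Igam_eq_comap (T : ℕ) : Igam ξ η T =
    (Ideal.span {(PowerSeries.X : PowerSeries (Polynomial ℂ)) ^ T}).comap (jetMap ξ η) := by
  apply le_antisymm
  · rw [Igam, Ideal.span_le]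
    rintro P ⟨⟨d, hd⟩, hP⟩
    rw [SetLike.mem_coe, Ideal.mem_comap, Ideal.mem_span_singleton, PowerSeries.X_pow_dvd_iff]
    exact fun i hi => (coeff_jetMap_eq_zero_iff ξ η hd i).mpr (hP i hi)
  · intro P hP
    rw [Ideal.mem_comap, Ideal.mem_span_singleton, PowerSeries.X_pow_dvd_iff] at hP
    rw [← sum_homogeneousComponent P]
    refine Ideal.sum_mem _ fun d hd => Ideal.subset_span
      ⟨⟨d, homogeneousComponent_isHomogeneous d P⟩, fun i hi => ?_⟩
    have h := factorial_mul_coeff_jetMap ξ η P i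
    rw [hP i hi, mul_zero] at h
    have h' := congrArg (fun q => Polynomial.coeff q d) h
    simpa [Polynomial.finsetSum_coeff, Polynomial.coeff_monomial, Finset.mem_range.mp hd]
      using h'.symm

theorem mem_Igam_iff_of_isHomogeneous {P : MvPolynomial (Fin 3) ℂ} {d : ℕ}
    (hP : P.IsHomogeneous d) (T : ℕ) :
    P ∈ Igam ξ η T ↔ ∀ i < T, eval ![1, ξ, η] (DD^[i] P) = 0 := by
  rw [Igam_eq_comap, Ideal.mem_comap, Ideal.mem_span_singleton, PowerSeries.X_pow_dvd_iff]
  exact forall₂_congr fun i _ => coeff_jetMap_eq_zero_iff ξ η hP i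

theorem mem_Igam_one {P : MvPolynomial (Fin 3) ℂ} : P ∈ Igam ξ η 1 ↔
    aeval ![Polynomial.X, Polynomial.C ξ * Polynomial.X, Polynomial.C η * Polynomial.X] P =
      (0 : Polynomial ℂ) := by
  rw [Igam_eq_comap, Ideal.mem_comap, Ideal.mem_span_singleton, pow_one, PowerSeries.X_dvd_iff,
    constantCoeff_jetMap]

theorem Igam_one_isPrime : (Igam ξ η 1).IsPrime := by
  rw [Igam_eq_comap, pow_one]
  have := PowerSeries.span_X_isPrime (R := Polynomial ℂ)
  exact Ideal.comap_isPrime _ _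

theorem radical_span_X_pow {T : ℕ} (hT : T ≠ 0) :
    (Ideal.span {(PowerSeries.X : PowerSeries (Polynomial ℂ)) ^ T}).radical =
      Ideal.span {PowerSeries.X} := by
  rw [← Ideal.span_singleton_pow, Ideal.radical_pow _ hT,
    (PowerSeries.span_X_isPrime (R := Polynomial ℂ)).radical]

theorem span_X_pow_isPrimary {T : ℕ} (hT : T ≠ 0) :
    (Ideal.span {(PowerSeries.X : PowerSeries (Polynomial ℂ)) ^ T}).IsPrimary := by
  rw [Ideal.isPrimary_iff, radical_span_X_pow hT]
  refine ⟨fun h => ?_, fun {x y} hxy => ?_⟩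
  · have := radical_span_X_pow hT
    rw [h, Ideal.radical_top] at this
    exact (PowerSeries.span_X_isPrime (R := Polynomial ℂ)).ne_top this.symm
  · simp only [Ideal.mem_span_singleton] at hxy ⊢
    refine or_iff_not_imp_right.mpr fun hy => ?_
    exact PowerSeries.X_prime.pow_dvd_of_dvd_mul_right T hy hxy

theorem Igam_isPrimary {T : ℕ} (hT : T ≠ 0) : (Igam ξ η T).IsPrimary := by
  rw [Igam_eq_comap]
  exact (span_X_pow_isPrimary hT).comap (jetMap ξ η).toRingHom

theorem radical_Igam {T : ℕ} (hT : T ≠ 0) : (Igam ξ η T).radical = Igam ξ η 1 := by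
  rw [Igam_eq_comap, Igam_eq_comap, ← Ideal.comap_radical, radical_span_X_pow hT, pow_one]

end Jets

section Height

variable (ξ η : ℂ)

theorem height_Igam_one_le (hp : (Igam ξ η 1).IsPrime) :
    Order.height (⟨Igam ξ η 1, hp⟩ : PrimeSpectrum (MvPolynomial (Fin 3) ℂ)) ≤ 2 := by
  let m : PrimeSpectrum (MvPolynomial (Fin 3) ℂ) :=
    ⟨RingHom.ker (eval (0 : Fin 3 → ℂ)), RingHom.ker_isPrime _⟩
  have hlt : (⟨Igam ξ η 1, hp⟩ : PrimeSpectrum (MvPolynomial (Fin 3) ℂ)) < m := by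
    rw [← PrimeSpectrum.asIdeal_lt_asIdeal]
    refine SetLike.lt_iff_le_and_exists.mpr ⟨fun P hP => ?_, X 0, ?_, ?_⟩
    · have hcomp : (Polynomial.aeval (0 : ℂ)).comp (aeval ![Polynomial.X,
          Polynomial.C ξ * Polynomial.X, Polynomial.C η * Polynomial.X]) =
          aeval (0 : Fin 3 → ℂ) := by
        ext i
        fin_cases i <;> simp
      rw [RingHom.mem_ker, ← coe_aeval_eq_eval, RingHom.coe_coe, ← hcomp, AlgHom.comp_apply,
        (mem_Igam_one ξ η).mp hP, map_zero]
    · simp [m, RingHom.mem_ker]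
    · simp [mem_Igam_one]
  have h1 := Order.height_add_one_le hlt
  have h2 : (Order.height m : WithBot ℕ∞) ≤ ((3 : ℕ∞) : WithBot ℕ∞) := by
    refine (Order.height_le_krullDim m).trans ?_
    have := MvPolynomial.ringKrullDim_of_isNoetherianRing (R := ℂ) (ι := Fin 3)
    rw [ringKrullDim] at this
    rw [this]
    simp
  exact (ENat.add_le_add_iff_right ENat.one_ne_top).mp
    ((h1.trans (WithBot.coe_le_coe.mp h2)).trans (by norm_num))

theorem two_le_height_Igam_one (hp : (Igam ξ η 1).IsPrime) :
    2 ≤ Order.height (⟨Igam ξ η 1, hp⟩ : PrimeSpectrum (MvPolynomial (Fin 3) ℂ)) := by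
  let φ : MvPolynomial (Fin 3) ℂ →ₐ[ℂ] MvPolynomial (Fin 3) ℂ := aeval ![X 0, C ξ * X 0, X 2]
  let q : PrimeSpectrum (MvPolynomial (Fin 3) ℂ) := ⟨RingHom.ker φ, RingHom.ker_isPrime _⟩
  let z : PrimeSpectrum (MvPolynomial (Fin 3) ℂ) := ⟨⊥, Ideal.isPrime_bot⟩
  have hzq : z < q := by
    rw [← PrimeSpectrum.asIdeal_lt_asIdeal]
    refine SetLike.lt_iff_le_and_exists.mpr ⟨bot_le, X 1 - C ξ * X 0, ?_, fun h => ?_⟩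
    · simp [q, φ, RingHom.mem_ker, algHom_C]
    · have := congrArg (eval ![0, 1, 0]) (Ideal.mem_bot.mp h)
      simp at this
  have hqI : q < ⟨Igam ξ η 1, hp⟩ := by
    rw [← PrimeSpectrum.asIdeal_lt_asIdeal]
    refine SetLike.lt_iff_le_and_exists.mpr ⟨fun P hP => ?_, X 2 - C η * X 0, ?_, fun h => ?_⟩
    · have hcomp : (aeval ![Polynomial.X, 0, Polynomial.C η * Polynomial.X]).comp φ =
          aeval ![Polynomial.X, Polynomial.C ξ * Polynomial.X,
            Polynomial.C η * Polynomial.X] := by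
        ext1 i
        fin_cases i <;> simp [φ, algHom_C, Polynomial.algebraMap_eq]
      rw [mem_Igam_one, ← hcomp, AlgHom.comp_apply, RingHom.mem_ker.mp hP, map_zero]
    · simp [mem_Igam_one, algHom_C, Polynomial.algebraMap_eq]
    · have := congrArg (eval ![0, 0, 1]) (RingHom.mem_ker.mp h)
      simp [φ, algHom_C] at this
  calc (2 : ℕ∞) = 0 + 1 + 1 := by norm_num
    _ ≤ Order.height z + 1 + 1 := by gcongr; exact zero_le
    _ ≤ Order.height q + 1 := by gcongr; exact Order.height_add_one_le hzq
    _ ≤ _ := Order.height_add_one_le hqI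

end Height

theorem stmt4 (ξ η : ℂ) (hη : η ≠ 0) (T : ℕ) (hT : 0 < T) :
    (Igam ξ η 1).IsPrime ∧
    (∃ hp : (Igam ξ η 1).IsPrime,
      Order.height (⟨Igam ξ η 1, hp⟩ : PrimeSpectrum (MvPolynomial (Fin 3) ℂ)) = 2) ∧
    (Igam ξ η T).IsPrimary ∧ (Igam ξ η T).radical = Igam ξ η 1 ∧
    ∀ D : ℕ, T ≤ Nat.choose (D + 2) 2 →
      Module.finrank ℂ
        (homogeneousSubmodule (Fin 3) ℂ D ⧸
          (Submodule.comap (homogeneousSubmodule (Fin 3) ℂ D).subtype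
            (Submodule.restrictScalars ℂ (Igam ξ η T)))) = T := by
  refine ⟨Igam_one_isPrime ξ η, ⟨Igam_one_isPrime ξ η, le_antisymm (height_Igam_one_le ξ η _)
    (two_le_height_Igam_one ξ η _)⟩, Igam_isPrimary ξ η hT.ne', radical_Igam ξ η hT.ne', ?_⟩
  intro D hD
  have hker : Submodule.comap (homogeneousSubmodule (Fin 3) ℂ D).subtype
      (Submodule.restrictScalars ℂ (Igam ξ η T)) = LinearMap.ker (jetHomogeneous ξ η D T) := by
    ext P
    rw [Submodule.mem_comap, Submodule.restrictScalars_mem, Submodule.subtype_apply,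
      mem_Igam_iff_of_isHomogeneous ξ η P.2, LinearMap.mem_ker, funext_iff, Fin.forall_iff]
    exact forall₂_congr fun i _ => by
      rw [← evalHomogeneous_ddHomogeneous_pow]
      rfl
  rw [hker, (LinearMap.quotKerEquivOfSurjective _ (jetHomogeneous_surjective hη
    (hD.trans_eq (finrank_homogeneousSubmodule D).symm))).finrank_eq, Module.finrank_fin_fun]
end

section
/- Let γ = (ξ,η) ∈ 𝒢 and let D, T ∈ ℕ* with T ≤ C(D+1,2). Then every homogeneous element of I^{(γ,T)} of degree ≥ D belongs to the ideal J of ℂ[X] generated by I^{(γ,T)}_D. -/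
open MvPolynomial

/-- The derivation `𝒟` as a bundled derivation. -/
noncomputable def derivationD : Derivation ℂ (MvPolynomial (Fin 3) ℂ) (MvPolynomial (Fin 3) ℂ) :=
  (X 0 : MvPolynomial (Fin 3) ℂ) • pderiv 1 + (X 2 : MvPolynomial (Fin 3) ℂ) • pderiv 2

theorem DD_eq_derivationD : DD = derivationD := by
  ext1 P
  simp [DD, derivationD]

theorem derivationD_X_zero : derivationD (X 0) = 0 := by
  simp [derivationD, pderiv_X]

theorem derivationD_X_one : derivationD (X 1) = X 0 := by
  simp [derivationD, pderiv_X]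

theorem derivationD_X_two : derivationD (X 2) = X 2 := by
  simp [derivationD, pderiv_X]

theorem DD_iterate_add (n : ℕ) (P Q : MvPolynomial (Fin 3) ℂ) :
    DD^[n] (P + Q) = DD^[n] P + DD^[n] Q := by
  rw [DD_eq_derivationD]; exact iterate_map_add derivationD n P Q

theorem DD_iterate_sub (n : ℕ) (P Q : MvPolynomial (Fin 3) ℂ) :
    DD^[n] (P - Q) = DD^[n] P - DD^[n] Q := by
  rw [DD_eq_derivationD]; exact iterate_map_sub derivationD n P Q

theorem DD_iterate_smul (n : ℕ) (c : ℂ) (P : MvPolynomial (Fin 3) ℂ) :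
    DD^[n] (c • P) = c • DD^[n] P := by
  rw [DD_eq_derivationD]
  induction n generalizing P with
  | zero => rfl
  | succ n ih => rw [Function.iterate_succ_apply, Derivation.map_smul, ih, Function.iterate_succ_apply]

theorem DD_iterate_X_zero_mul (n : ℕ) (P : MvPolynomial (Fin 3) ℂ) :
    DD^[n] (X 0 * P) = X 0 * DD^[n] P := by
  rw [DD_eq_derivationD]
  induction n generalizing P with
  | zero => rfl
  | succ n ih =>
    rw [Function.iterate_succ_apply, Derivation.leibniz, derivationD_X_zero, smul_zero, add_zero,
      smul_eq_mul, ih, Function.iterate_succ_apply]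

/-- Vanishing of the first `n` derivatives at a point is stable under multiplication. -/
theorem eval_DD_iterate_mul_eq_zero (v : Fin 3 → ℂ) (n : ℕ) (R Q : MvPolynomial (Fin 3) ℂ)
    (hQ : ∀ k ≤ n, eval v (DD^[k] Q) = 0) : eval v (DD^[n] (R * Q)) = 0 := by
  induction n generalizing R Q with
  | zero => simpa using Or.inr (hQ 0 le_rfl)
  | succ n ih =>
    have h : DD (R * Q) = R * DD Q + DD R * Q := by
      rw [DD_eq_derivationD, Derivation.leibniz]
      simp only [smul_eq_mul]
      ring
    rw [Function.iterate_succ_apply, h, DD_iterate_add, map_add,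
      ih R (DD Q) fun k hk => by
        rw [← Function.iterate_succ_apply]; exact hQ (k + 1) (by omega),
      ih (DD R) Q fun k hk => hQ k (by omega), add_zero]

theorem eval_DD_iterate_eq_zero_of_mem_Igam {ξ η : ℂ} {T : ℕ} {P : MvPolynomial (Fin 3) ℂ}
    (hP : P ∈ Igam ξ η T) {i : ℕ} (hi : i < T) : eval ![1, ξ, η] (DD^[i] P) = 0 := by
  unfold Igam at hP
  induction hP using Submodule.span_induction generalizing i with
  | mem P h => exact h.2 i hi
  | zero => rw [DD_eq_derivationD, iterate_map_zero, map_zero]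
  | add P Q _ _ hP hQ => rw [DD_iterate_add, map_add, hP hi, hQ hi, add_zero]
  | smul R Q _ hQ => exact eval_DD_iterate_mul_eq_zero _ i R Q fun k hk => hQ (by omega)

/-- The derivatives at `(1,ξ,η)` of `X₀^a (X₁ - ξX₀)^i X₂^j`, which restricts to
`η^j z^i e^{jz}` on the integral curve of `𝒟` through this point. -/
theorem eval_DD_iterate_monomial (ξ η : ℂ) (n a i j : ℕ) :
    eval ![1, ξ, η] (DD^[n] (X 0 ^ a * ((X 1 - C ξ * X 0) ^ i * X 2 ^ j))) =
      η ^ j * (Polynomial.derivative^[i] (Polynomial.X ^ n : Polynomial ℂ)).eval (j : ℂ) := by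
  induction n generalizing a i with
  | zero =>
    cases i with
    | zero => simp
    | succ i => simp [Polynomial.iterate_derivative_one]
  | succ n ih =>
    have hY : derivationD (X 1 - C ξ * X 0) = X 0 := by
      rw [map_sub, Derivation.leibniz, derivationD_X_zero, derivationD_X_one]
      simp [← algebraMap_eq]
    have h : DD (X 0 ^ a * ((X 1 - C ξ * X 0) ^ i * X 2 ^ j)) =
        (i : ℂ) • (X 0 ^ (a + 1) * ((X 1 - C ξ * X 0) ^ (i - 1) * X 2 ^ j)) +
        (j : ℂ) • (X 0 ^ a * ((X 1 - C ξ * X 0) ^ i * X 2 ^ j)) := by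
      rw [DD_eq_derivationD]
      simp only [Derivation.leibniz, Derivation.leibniz_pow, hY, derivationD_X_zero,
        derivationD_X_two, smul_eq_mul, smul_eq_C_mul, nsmul_eq_mul, map_natCast]
      rcases j with _ | j
      · simp; ring
      · simp; ring
    rw [Function.iterate_succ_apply, h, DD_iterate_add, DD_iterate_smul, DD_iterate_smul, map_add,
      smul_eval, smul_eval, ih, ih, pow_succ, Polynomial.iterate_derivative_mul_X]
    simp
    ring

theorem sum_range_sub_eq_choose (D : ℕ) : ∑ j ∈ Finset.range D, (D - j) = (D + 1).choose 2 := by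
  induction D with
  | zero => rfl
  | succ D ih =>
    rw [Finset.sum_range_succ', Nat.choose_succ_succ' (D + 1) 1, ← ih]
    simp
    ring

/-- Uniqueness in Hermite interpolation at the nodes `0, …, D - 1` with multiplicities
`D, …, 1`. -/
theorem Polynomial.eq_zero_of_iterate_derivative_eval_natCast {p : Polynomial ℂ} {D : ℕ}
    (hdeg : p.degree < ((D + 1).choose 2 : ℕ))
    (h : ∀ i j : ℕ, i + j < D → (Polynomial.derivative^[i] p).eval (j : ℂ) = 0) : p = 0 := by
  by_contra hp
  have hdvd : ∏ j ∈ Finset.range D, (Polynomial.X - Polynomial.C (j : ℂ)) ^ (D - j) ∣ p := by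
    refine Finset.prod_dvd_of_coprime ?_ ?_
    · intro a _ b _ hab
      refine (Polynomial.isCoprime_X_sub_C_of_isUnit_sub ?_).pow
      exact (sub_ne_zero.2 (by exact_mod_cast hab)).isUnit
    · intro j hj
      rw [Finset.mem_range] at hj
      rw [← Polynomial.le_rootMultiplicity_iff hp]
      have := Polynomial.lt_rootMultiplicity_of_isRoot_iterate_derivative (n := D - j - 1)
        (t := (j : ℂ)) hp fun m hm => h m j (by omega)
      omega
  have hle := Polynomial.natDegree_le_of_dvd hdvd hp
  rw [Polynomial.natDegree_prod_of_monic _ _ fun j _ => (Polynomial.monic_X_sub_C _).pow _] at hle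
  simp only [Polynomial.natDegree_pow, Polynomial.natDegree_X_sub_C, mul_one,
    sum_range_sub_eq_choose] at hle
  rw [← Polynomial.natDegree_lt_iff_degree_lt hp] at hdeg
  omega

/-- The jet of order `T` of a polynomial at `(1,ξ,η)` along `𝒟`. -/
noncomputable def jet (ξ η : ℂ) (T : ℕ) : MvPolynomial (Fin 3) ℂ →ₗ[ℂ] (Fin T → ℂ) where
  toFun P i := eval ![1, ξ, η] (DD^[i] P)
  map_add' P Q := by ext i; simp [DD_iterate_add]
  map_smul' c P := by ext i; simp [DD_iterate_smul, smul_eval]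

theorem isHomogeneous_X_zero_pow_mul_X_one_sub_pow_mul_X_two_pow (ξ : ℂ) (a i j : ℕ) :
    (X 0 ^ a * ((X 1 - C ξ * X 0) ^ i * X 2 ^ j) : MvPolynomial (Fin 3) ℂ).IsHomogeneous
      (a + (i + j)) := by
  have hY : (X 1 - C ξ * X 0 : MvPolynomial (Fin 3) ℂ).IsHomogeneous 1 :=
    (isHomogeneous_X ℂ 1).sub (by simpa using (isHomogeneous_C (Fin 3) ξ).mul (isHomogeneous_X ℂ 0))
  simpa using ((isHomogeneous_X ℂ (0 : Fin 3)).pow a).mul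
    ((hY.pow i).mul ((isHomogeneous_X ℂ (2 : Fin 3)).pow j))

/-- Every jet of order `T ≤ C(M+2,2)` is the jet of a homogeneous polynomial of degree `M`. -/
theorem map_jet_homogeneousSubmodule (ξ η : ℂ) (hη : η ≠ 0) (M T : ℕ)
    (hT : T ≤ (M + 2).choose 2) :
    (homogeneousSubmodule (Fin 3) ℂ M).map (jet ξ η T) = ⊤ := by
  by_contra hne
  obtain ⟨f, hf, hle⟩ := Submodule.exists_le_ker_of_lt_top _ (lt_top_iff_ne_top.2 hne)
  set p : Polynomial ℂ := ∑ i : Fin T, Polynomial.C (f (Pi.single i 1)) * Polynomial.X ^ (i : ℕ)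
    with hp
  have hf_apply (w : Fin T → ℂ) : f w = ∑ i, w i * f (Pi.single i 1) := by
    conv_lhs => rw [pi_eq_sum_univ' w]
    simp
  have hp0 : p = 0 := by
    refine Polynomial.eq_zero_of_iterate_derivative_eval_natCast (D := M + 1) ?_ ?_
    · refine lt_of_lt_of_le ?_ (Nat.cast_le.2 hT)
      exact Polynomial.degree_sum_fin_lt _
    · intro i j hij
      have hmem := hle (Submodule.mem_map_of_mem (f := jet ξ η T)
        ((mem_homogeneousSubmodule _ _).2
          (by simpa [show M - (i + j) + (i + j) = M by omega] using
            isHomogeneous_X_zero_pow_mul_X_one_sub_pow_mul_X_two_pow ξ (M - (i + j)) i j)))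
      rw [LinearMap.mem_ker, hf_apply] at hmem
      have heq : ∀ k : Fin T, jet ξ η T
          (X 0 ^ (M - (i + j)) * ((X 1 - C ξ * X 0) ^ i * X 2 ^ j)) k = η ^ j *
          (Polynomial.derivative^[i] (Polynomial.X ^ (k : ℕ) : Polynomial ℂ)).eval (j : ℂ) :=
        fun k => eval_DD_iterate_monomial ξ η k _ i j
      simp only [heq, mul_assoc, ← Finset.mul_sum] at hmem
      rw [hp, Polynomial.iterate_derivative_sum, Polynomial.eval_finsetSum]
      simp only [Polynomial.iterate_derivative_C_mul, Polynomial.eval_mul, Polynomial.eval_C]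
      simpa only [mul_comm] using (mul_eq_zero.1 hmem).resolve_left (pow_ne_zero _ hη)
  apply hf
  ext i
  have hc := congrArg (fun q : Polynomial ℂ => q.coeff i) hp0
  simpa [hp, Polynomial.finsetSum_coeff, Polynomial.coeff_X_pow, Fin.val_inj] using hc

/-- Modulo the ideal, every form of degree `M + 1` is a multiple of `X₀`. -/
theorem exists_isHomogeneous_sub_X_zero_mul_mem_Igam {ξ η : ℂ} (hη : η ≠ 0) {M T : ℕ}
    (hT : T ≤ (M + 2).choose 2) {Q : MvPolynomial (Fin 3) ℂ} (hQ : Q.IsHomogeneous (M + 1)) :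
    ∃ R : MvPolynomial (Fin 3) ℂ, R.IsHomogeneous M ∧ (Q - X 0 * R).IsHomogeneous (M + 1) ∧
      Q - X 0 * R ∈ Igam ξ η T := by
  obtain ⟨R, hR, hRQ⟩ : jet ξ η T Q ∈ (homogeneousSubmodule (Fin 3) ℂ M).map (jet ξ η T) := by
    rw [map_jet_homogeneousSubmodule ξ η hη M T hT]; trivial
  have hR : R.IsHomogeneous M := hR
  have hhom : (Q - X 0 * R).IsHomogeneous (M + 1) :=
    hQ.sub (by simpa [add_comm] using (isHomogeneous_X ℂ (0 : Fin 3)).mul hR)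
  refine ⟨R, hR, hhom, Ideal.subset_span ⟨⟨_, hhom⟩, fun i hi => ?_⟩⟩
  have h : eval ![1, ξ, η] (DD^[i] R) = eval ![1, ξ, η] (DD^[i] Q) := congrFun hRQ ⟨i, hi⟩
  rw [DD_iterate_sub, DD_iterate_X_zero_mul, map_sub, map_mul, h]
  simp

/-- A homogeneous element of degree `M + 2` of the ideal is a combination of the variables with
coefficients in the degree `M + 1` part of the ideal. -/
theorem exists_eq_X_mul_add_of_mem_Igam {ξ η : ℂ} (hη : η ≠ 0) {M T : ℕ}
    (hT : T ≤ (M + 2).choose 2) {P : MvPolynomial (Fin 3) ℂ} (hP : P ∈ Igam ξ η T)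
    (hPh : P.IsHomogeneous (M + 2)) :
    ∃ A : Fin 3 → MvPolynomial (Fin 3) ℂ,
      (∀ i, (A i).IsHomogeneous (M + 1) ∧ A i ∈ Igam ξ η T) ∧ P = ∑ i, X i * A i := by
  have hd (i : Fin 3) : (C ((M + 2 : ℕ) : ℂ)⁻¹ * pderiv i P).IsHomogeneous (M + 1) := by
    simpa using (isHomogeneous_C (Fin 3) (((M + 2 : ℕ) : ℂ)⁻¹)).mul (hPh.pderiv (i := i))
  have hsum : P = ∑ i, X i * (C ((M + 2 : ℕ) : ℂ)⁻¹ * pderiv i P) := by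
    have h := hPh.sum_X_mul_pderiv
    simp only [mul_left_comm (X _), ← Finset.mul_sum]
    rw [h, nsmul_eq_mul, ← mul_assoc, ← map_natCast (C (σ := Fin 3) (R := ℂ)), ← C_mul,
      inv_mul_cancel₀ (by exact_mod_cast Nat.succ_ne_zero (M + 1)), C_1, one_mul]
  obtain ⟨B, hd, hsum⟩ : ∃ B : Fin 3 → MvPolynomial (Fin 3) ℂ,
      (∀ i, (B i).IsHomogeneous (M + 1)) ∧ P = ∑ i, X i * B i := ⟨_, hd, hsum⟩
  obtain ⟨R, hR, hAh, hA⟩ := exists_isHomogeneous_sub_X_zero_mul_mem_Igam (ξ := ξ) hη hT (hd 1)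
  obtain ⟨S, hS, hBh, hB⟩ := exists_isHomogeneous_sub_X_zero_mul_mem_Igam (ξ := ξ) hη hT (hd 2)
  have hX {Q : MvPolynomial (Fin 3) ℂ} (k : Fin 3) (hQ : Q.IsHomogeneous M) :
      (X k * Q).IsHomogeneous (M + 1) := by
    simpa [add_comm] using (isHomogeneous_X ℂ k).mul hQ
  have hE : (B 0 + X 1 * R + X 2 * S).IsHomogeneous (M + 1) := ((hd 0).add (hX 1 hR)).add (hX 2 hS)
  have hEeq : X 0 * (B 0 + X 1 * R + X 2 * S) =
      P - (X 1 * (B 1 - X 0 * R) + X 2 * (B 2 - X 0 * S)) := by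
    rw [hsum, Fin.sum_univ_three]; ring
  have hEmem : X 0 * (B 0 + X 1 * R + X 2 * S) ∈ Igam ξ η T := by
    rw [hEeq]
    exact sub_mem hP (add_mem (Ideal.mul_mem_left _ _ hA) (Ideal.mul_mem_left _ _ hB))
  refine ⟨![B 0 + X 1 * R + X 2 * S, B 1 - X 0 * R, B 2 - X 0 * S], ?_, ?_⟩
  · intro i
    fin_cases i
    · refine ⟨hE, Ideal.subset_span ⟨⟨_, hE⟩, fun i hi => ?_⟩⟩
      simpa [DD_iterate_X_zero_mul] using eval_DD_iterate_eq_zero_of_mem_Igam hEmem hi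
    · exact ⟨hAh, hA⟩
    · exact ⟨hBh, hB⟩
  · rw [Fin.sum_univ_three]
    simp only [Matrix.cons_val]
    rw [hEeq]
    ring

theorem stmt6 (ξ η : ℂ) (hη : η ≠ 0) (D T : ℕ) (hD : 0 < D) (hT : 0 < T)
    (hT2 : T ≤ Nat.choose (D + 1) 2)
    (P : MvPolynomial (Fin 3) ℂ) (hP : P ∈ Igam ξ η T)
    (N : ℕ) (hN : D ≤ N) (hPh : P.IsHomogeneous N) :
    P ∈ Ideal.span {Q : MvPolynomial (Fin 3) ℂ | Q ∈ Igam ξ η T ∧ Q.IsHomogeneous D} := by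
  induction N, hN using Nat.le_induction generalizing P with
  | base => exact Ideal.subset_span ⟨hP, hPh⟩
  | succ N hN ih =>
    obtain ⟨M, rfl⟩ : ∃ M, N = M + 1 := ⟨N - 1, by omega⟩
    obtain ⟨A, hA, rfl⟩ := exists_eq_X_mul_add_of_mem_Igam hη
      (hT2.trans (Nat.choose_le_choose 2 (by omega))) hP hPh
    exact sum_mem fun i _ => Ideal.mul_mem_left _ _ (ih _ (hA i).2 (hA i).1)
end

section
/- Let γ = (ξ,η) ∈ 𝒢 and let D, T ∈ ℕ* with T ≤ C(D+1,2). For any finite set S of non-zero vectors of ℂ³ none of which is proportional to (1,ξ,η) (i.e. representing points of ℙ²(ℂ) distinct from (1:ξ:η)), there exists a polynomial P ∈ I^{(γ,T)}_D with P(s) ≠ 0 for every s ∈ S. -/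
open MvPolynomial

section DifferentialOperators

variable {K A : Type*} [CommRing K] [CommRing A] [Algebra K A] (δ : Derivation K A A)

theorem Polynomial.aeval_derivation_C_mul_X_pow_succ (a : K) (n : ℕ) (r : A) :
    Polynomial.aeval (δ : Module.End K A) (.C a * .X ^ (n + 1)) r =
      δ (Polynomial.aeval (δ : Module.End K A) (.C a * .X ^ n) r) := by
  have h : (Polynomial.C a * Polynomial.X ^ (n + 1) : Polynomial K) =
      Polynomial.X * (Polynomial.C a * Polynomial.X ^ n) := by ring
  rw [h, map_mul, Polynomial.aeval_X]
  rfl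

/-- If `δ x = y` and `δ y = 0` then `[c(δ), x] = y · c'(δ)`. -/
theorem Polynomial.aeval_derivation_mul_of_const {x y : A} (hx : δ x = y) (hy : δ y = 0)
    (c : Polynomial K) (r : A) :
    Polynomial.aeval (δ : Module.End K A) c (x * r) =
      x * Polynomial.aeval (δ : Module.End K A) c r +
        y * Polynomial.aeval (δ : Module.End K A) c.derivative r := by
  induction c using Polynomial.induction_on with
  | C a => simp [Module.algebraMap_end_apply]
  | add p q hp hq => simp only [map_add, LinearMap.add_apply, hp, hq]; ring
  | monomial n a ih =>
    have hd : Polynomial.derivative (Polynomial.C a * Polynomial.X ^ (n + 1)) =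
        Polynomial.C a * Polynomial.X ^ n +
          Polynomial.X * Polynomial.derivative (Polynomial.C a * Polynomial.X ^ n) := by
      rw [show (Polynomial.C a * Polynomial.X ^ (n + 1) : Polynomial K) =
        Polynomial.X * (Polynomial.C a * Polynomial.X ^ n) by ring, Polynomial.derivative_mul,
        Polynomial.derivative_X, one_mul]
    rw [aeval_derivation_C_mul_X_pow_succ, aeval_derivation_C_mul_X_pow_succ, ih, hd]
    simp only [map_add, map_mul (Polynomial.aeval (δ : Module.End K A)), Polynomial.aeval_X,
      LinearMap.add_apply, Module.End.mul_apply, Derivation.coeFn_coe, Derivation.leibniz,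
      smul_eq_mul, hx, hy]
    ring

/-- If `δ x = a x` then `c(δ) ∘ x = x · c(δ + a)`. -/
theorem Polynomial.aeval_derivation_mul_of_eigen {x : A} {a : K} (hx : δ x = a • x)
    (c : Polynomial K) (r : A) :
    Polynomial.aeval (δ : Module.End K A) c (x * r) =
      x * Polynomial.aeval (δ : Module.End K A) (Polynomial.taylor a c) r := by
  induction c using Polynomial.induction_on with
  | C a => simp [Module.algebraMap_end_apply]
  | add p q hp hq => simp only [map_add, LinearMap.add_apply, hp, hq]; ring
  | monomial n b ih =>
    have hd : Polynomial.taylor a (Polynomial.C b * Polynomial.X ^ (n + 1)) =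
        (Polynomial.X + Polynomial.C a) *
          Polynomial.taylor a (Polynomial.C b * Polynomial.X ^ n) := by
      rw [show (Polynomial.C b * Polynomial.X ^ (n + 1) : Polynomial K) =
        Polynomial.X * (Polynomial.C b * Polynomial.X ^ n) by ring, Polynomial.taylor_mul,
        Polynomial.taylor_X]
    rw [aeval_derivation_C_mul_X_pow_succ, ih, hd,
      map_mul (Polynomial.aeval (δ : Module.End K A))]
    simp only [map_add, Polynomial.aeval_X, Polynomial.aeval_C, Module.End.mul_apply,
      LinearMap.add_apply, Derivation.coeFn_coe, Module.algebraMap_end_apply, Derivation.leibniz,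
      smul_eq_mul, hx,
      Algebra.smul_def]
    ring

end DifferentialOperators

/-- A polynomial of degree less than `D (D + 1) / 2` with a root of multiplicity at least `D - k`
at each `k < D` is zero. -/
theorem Polynomial.eq_zero_of_iterate_derivative_eval_natCast_s7 {K : Type*} [Field K] [CharZero K]
    {D : ℕ} {e : Polynomial K} (hdeg : e.natDegree < (D + 1).choose 2)
    (h : ∀ j k : ℕ, j + k < D → (Polynomial.derivative^[j] e).eval (k : K) = 0) : e = 0 := by
  by_contra he
  have hdvd : (∏ k ∈ Finset.range D, (Polynomial.X - Polynomial.C (k : K)) ^ (D - k)) ∣ e := by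
    refine Finset.prod_dvd_of_coprime (fun k _ l _ hkl => ?_) fun k hk => ?_
    · exact (Polynomial.pairwise_coprime_X_sub_C (Nat.cast_injective (R := K)) hkl).pow
    · have hk' := Finset.mem_range.1 hk
      rw [← Polynomial.le_rootMultiplicity_iff he]
      have := Polynomial.lt_rootMultiplicity_of_isRoot_iterate_derivative (t := (k : K))
        (n := D - k - 1) he fun m hm => h m k (by omega)
      omega
  have hle := Polynomial.natDegree_le_of_dvd hdvd he
  rw [Polynomial.natDegree_prod_of_monic _ _ fun k _ => (Polynomial.monic_X_sub_C _).pow _] at hle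
  simp only [Polynomial.natDegree_pow, Polynomial.natDegree_X_sub_C, mul_one] at hle
  have hsum : ∑ k ∈ Finset.range D, (D - k) = (D + 1).choose 2 := by
    clear * -
    induction D with
    | zero => rfl
    | succ n ih =>
      rw [Finset.sum_range_succ', Nat.choose_succ_succ' (n + 1), Nat.choose_one_right]
      simp only [Nat.add_sub_add_right, ih, Nat.reduceAdd]
      omega
  omega

/-- `DD` as a derivation. -/
noncomputable def derivDD : Derivation ℂ (MvPolynomial (Fin 3) ℂ) (MvPolynomial (Fin 3) ℂ) :=
  (X 0 : MvPolynomial (Fin 3) ℂ) • pderiv 1 + (X 2 : MvPolynomial (Fin 3) ℂ) • pderiv 2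

theorem coe_derivDD : ⇑derivDD = DD := rfl

/-- The functional `P ↦ (c(𝒟) P)(1, ξ, η)`. -/
noncomputable def evalOp (ξ η : ℂ) (c : Polynomial ℂ) : MvPolynomial (Fin 3) ℂ →ₗ[ℂ] ℂ :=
  (MvPolynomial.aeval ![1, ξ, η]).toLinearMap ∘ₗ
    Polynomial.aeval (derivDD : Module.End ℂ (MvPolynomial (Fin 3) ℂ)) c

section evalOp

variable (ξ η : ℂ) (c d : Polynomial ℂ) (R : MvPolynomial (Fin 3) ℂ)

theorem evalOp_add : evalOp ξ η (c + d) R = evalOp ξ η c R + evalOp ξ η d R := by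
  simp [evalOp]

theorem evalOp_smul (a : ℂ) : evalOp ξ η (a • c) R = a * evalOp ξ η c R := by
  simp [evalOp]

theorem evalOp_X_pow (i : ℕ) : evalOp ξ η (.X ^ i) R = eval ![1, ξ, η] (DD^[i] R) := by
  simp only [evalOp, map_pow, Polynomial.aeval_X, LinearMap.comp_apply, Module.End.pow_apply]
  rfl

theorem evalOp_one : evalOp ξ η c 1 = c.eval 0 := by
  induction c using Polynomial.induction_on with
  | C a => simp [evalOp, Module.algebraMap_end_apply]
  | add p q hp hq => rw [evalOp_add, hp, hq, Polynomial.eval_add]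
  | monomial n a =>
    rw [Polynomial.C_mul', evalOp_smul, evalOp_X_pow, Function.iterate_succ_apply]
    have h1 : DD 1 = 0 := by rw [← coe_derivDD]; exact derivDD.map_one_eq_zero
    have h0 : DD 0 = 0 := by rw [← coe_derivDD]; exact map_zero _
    rw [h1, Function.iterate_fixed h0]
    simp

theorem evalOp_X_zero_mul : evalOp ξ η c (X 0 * R) = evalOp ξ η c R := by
  have h : derivDD (X 0) = 0 := by simp [derivDD, pderiv_X]
  rw [evalOp, LinearMap.comp_apply, Polynomial.aeval_derivation_mul_of_const _ h (map_zero _)]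
  simp

theorem evalOp_X_one_sub_mul :
    evalOp ξ η c ((X 1 - C ξ * X 0) * R) = evalOp ξ η c.derivative R := by
  have h0 : derivDD (X 0) = 0 := by simp [derivDD, pderiv_X]
  have h : derivDD (X 1 - C ξ * X 0) = X 0 := by simp [derivDD, pderiv_X]
  rw [evalOp, LinearMap.comp_apply, Polynomial.aeval_derivation_mul_of_const _ h h0]
  simp [evalOp]

variable {η}

theorem evalOp_X_two_mul (hη : η ≠ 0) :
    evalOp ξ η c (C η⁻¹ * X 2 * R) = evalOp ξ η (Polynomial.taylor 1 c) R := by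
  have h : derivDD (C η⁻¹ * X 2) = (1 : ℂ) • (C η⁻¹ * X 2) := by
    simp [derivDD, pderiv_X, mul_comm]
  rw [evalOp, LinearMap.comp_apply, Polynomial.aeval_derivation_mul_of_eigen _ h]
  simp [evalOp, hη]

theorem evalOp_monomial (hη : η ≠ 0) (j k l : ℕ) :
    evalOp ξ η c ((X 1 - C ξ * X 0) ^ j * ((C η⁻¹ * X 2) ^ k * X 0 ^ l)) =
      (Polynomial.derivative^[j] c).eval (k : ℂ) := by
  induction j generalizing c with
  | succ j ih => rw [pow_succ', mul_assoc, evalOp_X_one_sub_mul, ih, Function.iterate_succ_apply]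
  | zero =>
    rw [pow_zero, one_mul, Function.iterate_zero_apply]
    induction k generalizing c with
    | succ k ih =>
      rw [pow_succ', mul_assoc, evalOp_X_two_mul _ _ _ hη, ih, Polynomial.taylor_eval]
      push_cast; rfl
    | zero =>
      rw [pow_zero, one_mul, Nat.cast_zero]
      induction l with
      | zero => rw [pow_zero, evalOp_one]
      | succ l ih => rw [pow_succ', evalOp_X_zero_mul, ih]

end evalOp

/-- If `c(𝒟)` at `(1, ξ, η)` agrees on forms of degree `D` with evaluation at another point, and
`deg c < D (D + 1) / 2`, then `c = 0`. -/
theorem eq_zero_of_evalOp_eq_eval {ξ η : ℂ} (hη : η ≠ 0) {D : ℕ} (hD : 0 < D)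
    {s : Fin 3 → ℂ} (hs : ¬∃ a : ℂ, s = a • ![1, ξ, η]) {c : Polynomial ℂ}
    (hdeg : c.natDegree < (D + 1).choose 2)
    (h : ∀ P : MvPolynomial (Fin 3) ℂ, P.IsHomogeneous D → evalOp ξ η c P = eval s P) : c = 0 := by
  obtain ⟨a, b, d, hL, had⟩ : ∃ a b d : ℂ,
      a * s 0 + b * (s 1 - ξ * s 0) + d * (η⁻¹ * s 2) = 0 ∧ a + d ≠ 0 := by
    by_cases h1 : s 1 - ξ * s 0 = 0
    · refine ⟨η⁻¹ * s 2, 0, -s 0, by ring, fun h2 => hs ⟨s 0, ?_⟩⟩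
      have h2' : s 2 = η * s 0 := by field_simp at h2; linear_combination h2
      funext i
      fin_cases i
      · simp
      · simp; linear_combination h1
      · simp; linear_combination h2'
    · refine ⟨1, -s 0 / (s 1 - ξ * s 0), 0, ?_, by simp⟩
      rw [div_mul_cancel₀ _ h1]; ring
  set e := a • c + b • Polynomial.derivative c + d • Polynomial.taylor 1 c with he
  have hdege : e.natDegree ≤ c.natDegree := by
    refine Polynomial.natDegree_add_le_of_degree_le (Polynomial.natDegree_add_le_of_degree_le
      (Polynomial.natDegree_smul_le _ _) ?_) ?_
    · exact (Polynomial.natDegree_smul_le _ _).trans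
        ((Polynomial.natDegree_derivative_le c).trans (Nat.sub_le _ _))
    · exact (Polynomial.natDegree_smul_le _ _).trans (Polynomial.natDegree_taylor c 1).le
  have he0 : e = 0 := by
    refine Polynomial.eq_zero_of_iterate_derivative_eval_natCast_s7 (hdege.trans_lt hdeg)
      fun j k hjk => ?_
    rw [← evalOp_monomial ξ e hη j k (D - 1 - j - k)]
    set R : MvPolynomial (Fin 3) ℂ :=
      (X 1 - C ξ * X 0) ^ j * ((C η⁻¹ * X 2) ^ k * X 0 ^ (D - 1 - j - k)) with hR
    have h0 : (X 0 : MvPolynomial (Fin 3) ℂ).IsHomogeneous 1 := isHomogeneous_X _ _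
    have h1 : (X 1 - C ξ * X 0 : MvPolynomial (Fin 3) ℂ).IsHomogeneous 1 :=
      (isHomogeneous_X _ _).sub (isHomogeneous_C_mul_X _ _)
    have h2 : (C η⁻¹ * X 2 : MvPolynomial (Fin 3) ℂ).IsHomogeneous 1 := isHomogeneous_C_mul_X _ _
    have hRh : R.IsHomogeneous (D - 1) := by
      have := (h1.pow j).mul ((h2.pow k).mul (h0.pow (D - 1 - j - k)))
      convert this using 1
      omega
    have hx (P : MvPolynomial (Fin 3) ℂ) (hP : P.IsHomogeneous 1) :
        evalOp ξ η c (P * R) = eval s P * eval s R := by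
      rw [h, map_mul]
      convert hP.mul hRh using 1
      omega
    have e0 := hx _ h0
    have e1 := hx _ h1
    have e2 := hx _ h2
    rw [evalOp_X_zero_mul] at e0
    rw [evalOp_X_one_sub_mul] at e1
    rw [evalOp_X_two_mul _ _ _ hη] at e2
    simp only [map_sub, map_mul, eval_X, eval_C] at e0 e1 e2
    rw [he, evalOp_add, evalOp_add, evalOp_smul, evalOp_smul, evalOp_smul, e0, e1, e2]
    linear_combination eval s R * hL
  by_contra hc
  have hcoeff := congrArg (Polynomial.coeff · c.natDegree) he0
  have hder : (Polynomial.derivative c).coeff c.natDegree = 0 := by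
    rw [Polynomial.coeff_derivative, Polynomial.coeff_eq_zero_of_natDegree_lt (Nat.lt_succ_self _),
      zero_mul]
  simp only [he, Polynomial.coeff_add, Polynomial.coeff_smul, hder,
    Polynomial.coeff_taylor_natDegree,
    smul_eq_mul, Polynomial.coeff_zero, Polynomial.coeff_natDegree] at hcoeff
  refine mul_ne_zero had (Polynomial.leadingCoeff_ne_zero.2 hc) ?_
  linear_combination hcoeff

/-- The forms of degree `D` in the generating set of `Igam ξ η T`. -/
noncomputable def vanishingForms (ξ η : ℂ) (T D : ℕ) : Submodule ℂ (MvPolynomial (Fin 3) ℂ) :=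
  homogeneousSubmodule (Fin 3) ℂ D ⊓ ⨅ i : Fin T, LinearMap.ker (evalOp ξ η (.X ^ (i : ℕ)))

theorem exists_mem_vanishingForms_eval_ne_zero {ξ η : ℂ} (hη : η ≠ 0) {D T : ℕ} (hD : 0 < D)
    (hT : T ≤ (D + 1).choose 2) {s : Fin 3 → ℂ} (hs0 : s ≠ 0)
    (hs : ¬∃ a : ℂ, s = a • ![1, ξ, η]) :
    ∃ P ∈ vanishingForms ξ η T D, eval s P ≠ 0 := by
  by_contra! hcon
  let V := homogeneousSubmodule (Fin 3) ℂ D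
  have hmem : (MvPolynomial.aeval s).toLinearMap.domRestrict V ∈ Submodule.span ℂ
      (Set.range fun i : Fin T => (evalOp ξ η (.X ^ (i : ℕ))).domRestrict V) := by
    refine mem_span_of_iInf_ker_le_ker fun P hP => ?_
    simp only [Submodule.mem_iInf, LinearMap.mem_ker, LinearMap.domRestrict_apply] at hP ⊢
    exact hcon P ⟨P.2, by simpa using hP⟩
  obtain ⟨u, hu⟩ := (Submodule.mem_span_range_iff_exists_fun ℂ).1 hmem
  let c : Polynomial ℂ := ∑ i : Fin T, u i • Polynomial.X ^ (i : ℕ)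
  have hc (P : MvPolynomial (Fin 3) ℂ) (hP : P.IsHomogeneous D) : evalOp ξ η c P = eval s P := by
    have := LinearMap.congr_fun hu ⟨P, hP⟩
    simpa [c, evalOp] using this
  obtain ⟨i, hi⟩ := Function.ne_iff.1 hs0
  have hXi : (X i ^ D : MvPolynomial (Fin 3) ℂ).IsHomogeneous D := by
    simpa using (isHomogeneous_X ℂ i).pow D
  have hne := hc _ hXi
  have hc0 : c = 0 := by
    by_contra hc0
    refine hc0 (eq_zero_of_evalOp_eq_eval hη hD hs ?_ hc)
    refine lt_of_lt_of_le ((Polynomial.natDegree_lt_iff_degree_lt hc0).2 ?_) hT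
    refine Polynomial.mem_degreeLT.1 (Submodule.sum_mem _ fun i _ => Submodule.smul_mem _ _ ?_)
    rw [Polynomial.mem_degreeLT, Polynomial.degree_X_pow]
    exact_mod_cast i.2
  rw [hc0] at hne
  simp only [evalOp, map_zero, LinearMap.comp_zero, LinearMap.zero_apply, map_pow, eval_X] at hne
  exact pow_ne_zero D hi hne.symm

theorem stmt7 (ξ η : ℂ) (hη : η ≠ 0) (D T : ℕ) (hD : 0 < D) (hT : 0 < T)
    (hT2 : T ≤ Nat.choose (D + 1) 2)
    (S : Finset (Fin 3 → ℂ))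
    (hS : ∀ s ∈ S, s ≠ 0 ∧ ¬∃ c : ℂ, s = c • ![1, ξ, η]) :
    ∃ P ∈ Igam ξ η T, P.IsHomogeneous D ∧ ∀ s ∈ S, eval s P ≠ 0 := by
  obtain ⟨P, hP, hPS⟩ := Module.Dual.exists_forall_mem_ne_zero_of_forall_exists
    (vanishingForms ξ η T D) (fun s : S => (MvPolynomial.aeval (s : Fin 3 → ℂ)).toLinearMap)
    fun s => exists_mem_vanishingForms_eval_ne_zero hη hD hT2 (hS s s.2).1 (hS s s.2).2
  refine ⟨P, Ideal.subset_span ⟨⟨D, hP.1⟩, fun i hi => ?_⟩, hP.1, fun s hs => hPS ⟨s, hs⟩⟩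
  rw [← evalOp_X_pow]
  exact (Submodule.mem_iInf _).1 hP.2 ⟨i, hi⟩
end
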